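/- arXiv:2405.15543 — 3 statements merged into one kernel-verified Lean document; each statement's English description precedes it below -/
import Mathlib

section
/- Every finite simple graph that does not contain the butterfly as an induced minor is 3-creature-free. -/
open SimpleGraph

/-! ### Minimal separators, tame and feral classes -/

/-- `S` separates `a` from `b` in `G`: `a, b` lie in distinct connected components of `G − S`,
i.e. every walk from `a` to `b` meets `S`. -/
def Separates {V : Type} (G : SimpleGraph V) (S : Set V) (a b : V) : Prop :=
  ∀ p : G.Walk a b, ∃ x ∈ p.support, x ∈ S

/-- `S` is a minimal separator of `G`: some nonadjacent pair `a, b` outside `S` lies in distinct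
components of `G − S`, while for every proper subset `S' ⊊ S` they lie in the same component
of `G − S'`. -/
def IsMinimalSeparator {V : Type} (G : SimpleGraph V) (S : Set V) : Prop :=
  ∃ a b : V, a ∉ S ∧ b ∉ S ∧ a ≠ b ∧ ¬ G.Adj a b ∧ Separates G S a b ∧
    ∀ S' : Set V, S' ⊂ S → ¬ Separates G S' a b

/-- The number of minimal separators of a graph on `Fin n`. -/
noncomputable def numMinSep {n : ℕ} (G : SimpleGraph (Fin n)) : ℕ :=
  {S : Set (Fin n) | IsMinimalSeparator G S}.ncard

/-- A class of finite simple graphs (one collection for each number of vertices) is tame if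
some polynomial bounds the number of minimal separators of all its members. -/
def Tame (𝒢 : ∀ n : ℕ, SimpleGraph (Fin n) → Prop) : Prop :=
  ∃ p : Polynomial ℕ, ∀ (n : ℕ) (G : SimpleGraph (Fin n)), 𝒢 n G → numMinSep G ≤ p.eval n

/-- A class of finite simple graphs is feral if for some real `c > 1` there are infinitely many
graphs `G` in the class with at least `c ^ |V(G)|` minimal separators. -/
def Feral (𝒢 : ∀ n : ℕ, SimpleGraph (Fin n) → Prop) : Prop :=
  ∃ c : ℝ, 1 < c ∧ ∀ N : ℕ, ∃ n : ℕ, N ≤ n ∧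
    ∃ G : SimpleGraph (Fin n), 𝒢 n G ∧ (c ^ n : ℝ) ≤ (numMinSep G : ℝ)

/-! ### Minors and induced minors via models -/

/-- An induced minor model of `H` in `G`. -/
def IsInducedMinorModel {V W : Type} (G : SimpleGraph V) (H : SimpleGraph W)
    (X : W → Set V) : Prop :=
  (∀ w, (X w).Nonempty) ∧
  (∀ w, (G.induce (X w)).Connected) ∧
  (Pairwise fun u w => Disjoint (X u) (X w)) ∧
  (∀ u w, H.Adj u w → ∃ a ∈ X u, ∃ b ∈ X w, G.Adj a b) ∧
  (∀ u w, u ≠ w → ¬ H.Adj u w → ∀ a ∈ X u, ∀ b ∈ X w, ¬ G.Adj a b)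

/-- `H` is an induced minor of `G`. -/
def InducedMinor {V W : Type} (H : SimpleGraph W) (G : SimpleGraph V) : Prop :=
  ∃ X : W → Set V, IsInducedMinorModel G H X

/-- A minor model of `H` in `G` (edges between branch sets of nonadjacent vertices allowed). -/
def IsMinorModel {V W : Type} (G : SimpleGraph V) (H : SimpleGraph W)
    (X : W → Set V) : Prop :=
  (∀ w, (X w).Nonempty) ∧
  (∀ w, (G.induce (X w)).Connected) ∧
  (Pairwise fun u w => Disjoint (X u) (X w)) ∧
  (∀ u w, H.Adj u w → ∃ a ∈ X u, ∃ b ∈ X w, G.Adj a b)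

/-- `H` is a minor of `G`. -/
def IsMinorOf {V W : Type} (H : SimpleGraph W) (G : SimpleGraph V) : Prop :=
  ∃ X : W → Set V, IsMinorModel G H X

/-! ### Subdivisions -/

/-- The graph obtained from `H` by subdividing the edge `uv`: the new vertex is `none`, it is
joined to `u` and `v`, the edge `uv` is removed and everything else is unchanged. -/
def subdivideEdge {W : Type} (H : SimpleGraph W) (u v : W) : SimpleGraph (Option W) :=
  SimpleGraph.fromRel fun x y =>
    (∃ a b : W, x = some a ∧ y = some b ∧ H.Adj a b ∧ ¬(a = u ∧ b = v) ∧ ¬(a = v ∧ b = u)) ∨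
    (x = none ∧ (y = some u ∨ y = some v))

/-- `Subdivision H H'` holds when `H'` is obtained from `H` by repeatedly subdividing edges. -/
inductive Subdivision : {A : Type} → SimpleGraph A → {B : Type} → SimpleGraph B → Prop where
  | refl {A : Type} (G : SimpleGraph A) : Subdivision G G
  | step {A : Type} {G : SimpleGraph A} {B : Type} {H : SimpleGraph B} {u v : B} :
      Subdivision G H → H.Adj u v → Subdivision G (subdivideEdge H u v)

/-- `G` contains an induced subdivision of `H`, i.e. `H` is an induced topological minor
of `G`: some subdivision of `H` is isomorphic to an induced subgraph of `G`. -/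
def ContainsInducedSubdivision {A V : Type} (H : SimpleGraph A) (G : SimpleGraph V) : Prop :=
  ∃ (B : Type) (H' : SimpleGraph B), Subdivision H H' ∧ Nonempty (H' ↪g G)

/-! ### Particular graphs -/

/-- `2P₂`: the disjoint union of two edges. -/
def twoP2 : SimpleGraph (Fin 4) :=
  SimpleGraph.fromRel fun v w => (v = 0 ∧ w = 1) ∨ (v = 2 ∧ w = 3)

/-- The diamond: `K₄` minus the edge `03`. -/
def diamond : SimpleGraph (Fin 4) :=
  SimpleGraph.fromRel fun v w => ¬(v = 0 ∧ w = 3) ∧ ¬(v = 3 ∧ w = 0)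

/-- The butterfly: two triangles `{0,1,2}` and `{0,3,4}` sharing the vertex `0`. -/
def butterfly : SimpleGraph (Fin 5) :=
  SimpleGraph.fromRel fun v w =>
    (v = 0 ∧ w = 1) ∨ (v = 0 ∧ w = 2) ∨ (v = 1 ∧ w = 2) ∨
    (v = 0 ∧ w = 3) ∨ (v = 0 ∧ w = 4) ∨ (v = 3 ∧ w = 4)

/-- The house: the `5`-cycle `0-1-2-3-4-0` together with the chord `03`. -/
def house : SimpleGraph (Fin 5) :=
  SimpleGraph.fromRel fun v w =>
    (v = 0 ∧ w = 1) ∨ (v = 1 ∧ w = 2) ∨ (v = 2 ∧ w = 3) ∨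
    (v = 3 ∧ w = 4) ∨ (v = 0 ∧ w = 4) ∨ (v = 0 ∧ w = 3)

/-- `K₃ + P₁`: a triangle together with an isolated vertex. -/
def k3PlusP1 : SimpleGraph (Fin 4) :=
  SimpleGraph.fromRel fun v w => (v = 0 ∧ w = 1) ∨ (v = 0 ∧ w = 2) ∨ (v = 1 ∧ w = 2)

/-- The (short) `k`-theta: vertices `a = inl 0`, `b = inl 1`, `aᵢ = inr (i, 0)`,
`bᵢ = inr (i, 1)`, with edges `a aᵢ`, `aᵢ bᵢ`, `bᵢ b`. -/
def thetaGraph (k : ℕ) : SimpleGraph (Fin 2 ⊕ Fin k × Fin 2) :=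
  SimpleGraph.fromRel fun v w =>
    (∃ i, v = Sum.inl 0 ∧ w = Sum.inr (i, 0)) ∨
    (∃ i, v = Sum.inl 1 ∧ w = Sum.inr (i, 1)) ∨
    (∃ i, v = Sum.inr (i, 0) ∧ w = Sum.inr (i, 1))

/-- The (short) `k`-prism: two `k`-cliques `{(i,0)}` and `{(i,1)}` with a perfect matching. -/
def prismGraph (k : ℕ) : SimpleGraph (Fin k × Fin 2) :=
  SimpleGraph.fromRel fun v w => (v.2 = w.2 ∧ v.1 ≠ w.1) ∨ (v.1 = w.1 ∧ v.2 ≠ w.2)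

/-- The `k`-skinny ladder: paths `p_i = (i,0)`, `q_i = (i,1)`, independent set `r_i = (i,2)`,
with edges `p_i p_{i+1}`, `q_i q_{i+1}`, `p_i r_i`, `q_i r_i`. -/
def skinnyLadder (k : ℕ) : SimpleGraph (Fin k × Fin 3) :=
  SimpleGraph.fromRel fun v w =>
    (v.2 = w.2 ∧ v.2 ≠ 2 ∧ w.1.val = v.1.val + 1) ∨
    (v.1 = w.1 ∧ v.2 ≠ 2 ∧ w.2 = 2)

/-- `gammaGraph p q r` is the graph `Γ` consisting of two vertices `a = inl 0` and `b = inl 1`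
joined by three internally disjoint paths with `p`, `q`, `r` internal vertices respectively
(so of lengths `p+1`, `q+1`, `r+1`); i.e. `Γ_{p+1, q+1, r+1}`. -/
def gammaGraph (p q r : ℕ) : SimpleGraph (Fin 2 ⊕ (Fin p ⊕ (Fin q ⊕ Fin r))) :=
  SimpleGraph.fromRel fun v w =>
    match v, w with
    | Sum.inl x, Sum.inl y => x = 0 ∧ y = 1 ∧ (p = 0 ∨ q = 0 ∨ r = 0)
    | Sum.inl x, Sum.inr (Sum.inl t) => (x = 0 ∧ t.val = 0) ∨ (x = 1 ∧ t.val = p - 1)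
    | Sum.inl x, Sum.inr (Sum.inr (Sum.inl t)) => (x = 0 ∧ t.val = 0) ∨ (x = 1 ∧ t.val = q - 1)
    | Sum.inl x, Sum.inr (Sum.inr (Sum.inr t)) => (x = 0 ∧ t.val = 0) ∨ (x = 1 ∧ t.val = r - 1)
    | Sum.inr (Sum.inl t), Sum.inr (Sum.inl s) => s.val = t.val + 1
    | Sum.inr (Sum.inr (Sum.inl t)), Sum.inr (Sum.inr (Sum.inl s)) => s.val = t.val + 1
    | Sum.inr (Sum.inr (Sum.inr t)), Sum.inr (Sum.inr (Sum.inr s)) => s.val = t.val + 1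
    | _, _ => False

/-- The long twin wheel on a cycle of length `n`: the cycle `0-1-⋯-(n-1)-0` on `Fin n`
together with a center adjacent exactly to the consecutive vertices `0`, `1`, `2`. -/
def longTwinWheel (n : ℕ) : SimpleGraph (Fin n ⊕ Unit) :=
  SimpleGraph.fromRel fun v w =>
    match v, w with
    | Sum.inl a, Sum.inl b => b.val = a.val + 1 ∨ (a.val = n - 1 ∧ b.val = 0)
    | Sum.inl a, Sum.inr _ => a.val = 0 ∨ a.val = 1 ∨ a.val = 2
    | _, _ => False

/-! ### Thin walks -/

/-- A thin walk in `H`: a walk whose vertices are pairwise distinct except that possibly the two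
endpoints coincide, and all of whose internal vertices have degree `2` in `H`. -/
def IsThinWalk {V : Type} (H : SimpleGraph V) {x y : V} (p : H.Walk x y) : Prop :=
  p.support.tail.Nodup ∧ p.support.dropLast.Nodup ∧
    ∀ v ∈ p.support.tail.dropLast, (H.neighborSet v).ncard = 2

/-! ### Creatures -/

/-- A `k`-creature in `G` on the pairwise disjoint nonempty vertex sets `A`, `B`, `X`, `Y`. -/
def IsCreature {V : Type} (G : SimpleGraph V) (k : ℕ) (A B X Y : Set V) : Prop :=
  A.Nonempty ∧ B.Nonempty ∧
  Disjoint A B ∧ Disjoint A X ∧ Disjoint A Y ∧ Disjoint B X ∧ Disjoint B Y ∧ Disjoint X Y ∧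
  (G.induce A).Connected ∧ (G.induce B).Connected ∧
  (∀ a ∈ A, ∀ b ∈ B, ¬ G.Adj a b) ∧
  (∀ a ∈ A, ∀ y ∈ Y, ¬ G.Adj a y) ∧
  (∀ b ∈ B, ∀ x ∈ X, ¬ G.Adj b x) ∧
  (∀ x ∈ X, ∃ a ∈ A, G.Adj x a) ∧
  (∀ y ∈ Y, ∃ b ∈ B, G.Adj y b) ∧
  ∃ (x : Fin k → V) (y : Fin k → V), Function.Injective x ∧ Function.Injective y ∧
    X = Set.range x ∧ Y = Set.range y ∧ ∀ i j, G.Adj (x i) (y j) ↔ i = j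

/-- `G` is `k`-creature-free. -/
def CreatureFree {V : Type} (G : SimpleGraph V) (k : ℕ) : Prop :=
  ¬ ∃ A B X Y : Set V, IsCreature G k A B X Y

/-! ### Distance to minor-closed classes, feedback vertex set number -/

/-- `cFam F G`: the least size of a vertex set `S` such that `G − S` has no minor isomorphic
to a member of the family `F`. -/
noncomputable def cFam {V : Type} (F : ∀ n : ℕ, SimpleGraph (Fin n) → Prop)
    (G : SimpleGraph V) : ℕ :=
  sInf {k | ∃ S : Set V, S.ncard = k ∧
    ∀ (n : ℕ) (H : SimpleGraph (Fin n)), F n H → ¬ IsMinorOf H (G.induce Sᶜ)}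

/-- The feedback vertex set number of `G`. -/
noncomputable def fvs {V : Type} (G : SimpleGraph V) : ℕ :=
  sInf {k | ∃ S : Set V, S.ncard = k ∧ (G.induce Sᶜ).IsAcyclic}

/-! ### Long unichords and long thetas -/

/-- `G` has a long unichord: an edge which is the unique chord of some cycle of length ≥ 5. -/
def HasLongUnichord {V : Type} (G : SimpleGraph V) : Prop :=
  ∃ (v : V) (c : G.Walk v v), c.IsCycle ∧ 5 ≤ c.length ∧
    ∃ a b : V, a ∈ c.support ∧ b ∈ c.support ∧ G.Adj a b ∧ s(a, b) ∉ c.edges ∧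
      ∀ x y : V, x ∈ c.support → y ∈ c.support → G.Adj x y → s(x, y) ∉ c.edges →
        s(x, y) = s(a, b)

/-- `G` is long-theta-free: no induced subgraph of `G` is a theta `Γ_{i,j,k}` with
`i, j, k ≥ 2` and at least one of `i, j, k` at least `3`. -/
def LongThetaFree {V : Type} (G : SimpleGraph V) : Prop :=
  ¬ ∃ i j k : ℕ, 2 ≤ i ∧ 2 ≤ j ∧ 2 ≤ k ∧ (3 ≤ i ∨ 3 ≤ j ∨ 3 ≤ k) ∧
    Nonempty (gammaGraph (i - 1) (j - 1) (k - 1) ↪g G)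

/-- An induced minor model of the butterfly, given by the branch set `C` of the center and the
branch sets `P, Q` and `R, S` of the two edges not containing the center. -/
theorem inducedMinor_butterfly_of_branchSets {V : Type} {G : SimpleGraph V} {C P Q R S : Set V}
    (hC : (G.induce C).Connected) (hP : (G.induce P).Connected) (hQ : (G.induce Q).Connected)
    (hR : (G.induce R).Connected) (hS : (G.induce S).Connected)
    (dC : Disjoint C P ∧ Disjoint C Q ∧ Disjoint C R ∧ Disjoint C S)
    (dPQ : Disjoint P Q) (dRS : Disjoint R S)
    (dPQRS : Disjoint (P ∪ Q) (R ∪ S))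
    (hCP : ∃ c ∈ C, ∃ p ∈ P, G.Adj c p) (hCQ : ∃ c ∈ C, ∃ q ∈ Q, G.Adj c q)
    (hCR : ∃ c ∈ C, ∃ r ∈ R, G.Adj c r) (hCS : ∃ c ∈ C, ∃ s ∈ S, G.Adj c s)
    (hPQ : ∃ p ∈ P, ∃ q ∈ Q, G.Adj p q) (hRS : ∃ r ∈ R, ∃ s ∈ S, G.Adj r s)
    (hanti : ∀ u ∈ P ∪ Q, ∀ v ∈ R ∪ S, ¬ G.Adj u v) :
    InducedMinor butterfly G := by
  have flip : ∀ {T U : Set V}, (∃ t ∈ T, ∃ u ∈ U, G.Adj t u) → ∃ u ∈ U, ∃ t ∈ T, G.Adj u t :=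
    fun ⟨t, ht, u, hu, h⟩ => ⟨u, hu, t, ht, h.symm⟩
  have hanti' : ∀ u ∈ R ∪ S, ∀ v ∈ P ∪ Q, ¬ G.Adj u v := fun u hu v hv h => hanti v hv u hu h.symm
  simp only [Set.disjoint_union_left, Set.disjoint_union_right] at dPQRS
  obtain ⟨⟨dPR, dQR⟩, dPS, dQS⟩ := dPQRS
  obtain ⟨dCP, dCQ, dCR, dCS⟩ := dC
  have hconn : ∀ w, (G.induce ((![C, P, Q, R, S] : Fin 5 → Set V) w)).Connected := by
    intro w
    fin_cases w <;> assumption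
  refine ⟨![C, P, Q, R, S], fun w => ?_, hconn, ?_, ?_, ?_⟩
  · obtain ⟨v⟩ := (hconn w).nonempty
    exact ⟨v.1, v.2⟩
  · intro u w huw
    fin_cases u <;> fin_cases w <;>
      first
      | exact absurd rfl huw
      | assumption
      | (apply Disjoint.symm; assumption)
  · intro u w huw
    fin_cases u <;> fin_cases w <;>
      first
      | assumption
      | (apply flip; assumption)
      | simp [butterfly] at huw
  · intro u w huw hn a ha b hb
    fin_cases u <;> fin_cases w <;>
      first
      | exact absurd rfl huw
      | exact hanti a (.inl ha) b (.inl hb)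
      | exact hanti a (.inl ha) b (.inr hb)
      | exact hanti a (.inr ha) b (.inl hb)
      | exact hanti a (.inr ha) b (.inr hb)
      | exact hanti' a (.inl ha) b (.inl hb)
      | exact hanti' a (.inl ha) b (.inr hb)
      | exact hanti' a (.inr ha) b (.inl hb)
      | exact hanti' a (.inr ha) b (.inr hb)
      | simp [butterfly] at hn

theorem SimpleGraph.induce_singleton_connected {V : Type} (G : SimpleGraph V) (v : V) :
    (G.induce {v}).Connected where
  preconnected := Preconnected.of_subsingleton
  nonempty := ⟨⟨v, rfl⟩⟩

/-- A `k`-creature with enumerated sides `x` and `y`. -/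
structure IsEnumCreature {V : Type} (G : SimpleGraph V) {k : ℕ} (A B : Set V) (x y : Fin k → V) :
    Prop where
  connA : (G.induce A).Connected
  connB : (G.induce B).Connected
  disjAB : Disjoint A B
  xA : ∀ i, x i ∉ A
  yA : ∀ i, y i ∉ A
  xB : ∀ i, x i ∉ B
  yB : ∀ i, y i ∉ B
  xy : ∀ i j, x i ≠ y j
  injX : Function.Injective x
  injY : Function.Injective y
  antiAB : ∀ a ∈ A, ∀ b ∈ B, ¬ G.Adj a b
  antiAY : ∀ a ∈ A, ∀ i, ¬ G.Adj a (y i)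
  antiBX : ∀ b ∈ B, ∀ i, ¬ G.Adj b (x i)
  adjA : ∀ i, ∃ a ∈ A, G.Adj (x i) a
  adjB : ∀ i, ∃ b ∈ B, G.Adj (y i) b
  adjXY : ∀ i j, G.Adj (x i) (y j) ↔ i = j

namespace IsEnumCreature

variable {V : Type} {G : SimpleGraph V} {k : ℕ} {A B : Set V} {x y : Fin k → V}

theorem symm (h : IsEnumCreature G A B x y) : IsEnumCreature G B A y x where
  connA := h.connB
  connB := h.connA
  disjAB := h.disjAB.symm
  xA := h.yB
  yA := h.xB
  xB := h.yA
  yB := h.xA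
  xy i j := (h.xy j i).symm
  injX := h.injY
  injY := h.injX
  antiAB b hb a ha hab := h.antiAB a ha b hb hab.symm
  antiAY := h.antiBX
  antiBX := h.antiAY
  adjA := h.adjB
  adjB := h.adjA
  adjXY i j := by rw [G.adj_comm, h.adjXY, eq_comm]

/-- If two of the matching edges are anticomplete, then contracting both connected sides together
with a third matching edge gives the center of a butterfly. -/
theorem inducedMinor_butterfly_of_not_adj (h : IsEnumCreature G A B x y) {i j l : Fin k}
    (hij : i ≠ j) (hil : i ≠ l) (hjl : j ≠ l) (hx : ¬ G.Adj (x j) (x l))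
    (hy : ¬ G.Adj (y j) (y l)) : InducedMinor butterfly G := by
  have hxy : ∀ m, G.Adj (x m) (y m) := fun m => (h.adjXY m m).2 rfl
  obtain ⟨a, ha, hai⟩ := h.adjA i
  obtain ⟨b, hb, hbi⟩ := h.adjB i
  obtain ⟨a₁, ha₁, haj⟩ := h.adjA j
  obtain ⟨b₁, hb₁, hbj⟩ := h.adjB j
  obtain ⟨a₂, ha₂, hal⟩ := h.adjA l
  obtain ⟨b₂, hb₂, hbl⟩ := h.adjB l
  have hC : (G.induce (A ∪ {x i, y i} ∪ B)).Connected :=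
    connected_induce_union
      (connected_induce_union h.connA.preconnected
        (induce_pair_connected_of_adj (hxy i)).preconnected
        ha (w := x i) (by simp) hai.symm).preconnected
      h.connB.preconnected (v := y i) (by simp) hb hbi
  have hxj : x j ∉ A ∪ {x i, y i} ∪ B := by
    simp [h.xA, h.xB, h.xy, h.injX.eq_iff, hij.symm]
  have hyj : y j ∉ A ∪ {x i, y i} ∪ B := by
    simp [h.yA, h.yB, (h.xy _ _).symm, h.injY.eq_iff, hij.symm]
  have hxl : x l ∉ A ∪ {x i, y i} ∪ B := by
    simp [h.xA, h.xB, h.xy, h.injX.eq_iff, hil.symm]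
  have hyl : y l ∉ A ∪ {x i, y i} ∪ B := by
    simp [h.yA, h.yB, (h.xy _ _).symm, h.injY.eq_iff, hil.symm]
  refine inducedMinor_butterfly_of_branchSets hC
    (G.induce_singleton_connected (x j)) (G.induce_singleton_connected (y j))
    (G.induce_singleton_connected (x l)) (G.induce_singleton_connected (y l))
    (by simpa only [Set.disjoint_singleton_right] using ⟨hxj, hyj, hxl, hyl⟩)
    (by simp [h.xy]) (by simp [h.xy]) ?_
    ⟨a₁, by simp [ha₁], _, rfl, haj.symm⟩ ⟨b₁, by simp [hb₁], _, rfl, hbj.symm⟩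
    ⟨a₂, by simp [ha₂], _, rfl, hal.symm⟩ ⟨b₂, by simp [hb₂], _, rfl, hbl.symm⟩
    ⟨_, rfl, _, rfl, hxy j⟩ ⟨_, rfl, _, rfl, hxy l⟩ ?_
  · simp [h.xy, (h.xy _ _).symm, h.injX.eq_iff, h.injY.eq_iff, hjl.symm]
  · rintro u (rfl | rfl) v (rfl | rfl)
    · exact hx
    · simpa [h.adjXY] using hjl
    · rw [G.adj_comm]
      simpa [h.adjXY] using hjl.symm
    · exact hy

/-- If `x i` is adjacent to both `x j` and `x l`, then `{x i, x l, y l}` is the center of a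
butterfly whose other branch sets are `A`, `{x j}` and `{y i}`, `B`. -/
theorem inducedMinor_butterfly_of_adj (h : IsEnumCreature G A B x y) {i j l : Fin k}
    (hij : i ≠ j) (hil : i ≠ l) (hjl : j ≠ l) (hxj : G.Adj (x i) (x j))
    (hxl : G.Adj (x i) (x l)) : InducedMinor butterfly G := by
  have hxy : ∀ m, G.Adj (x m) (y m) := fun m => (h.adjXY m m).2 rfl
  obtain ⟨a, ha, hai⟩ := h.adjA i
  obtain ⟨b, hb, hbi⟩ := h.adjB i
  obtain ⟨a₁, ha₁, haj⟩ := h.adjA j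
  obtain ⟨b₂, hb₂, hbl⟩ := h.adjB l
  have hC : (G.induce ({x i, x l} ∪ {y l})).Connected :=
    connected_induce_union (induce_pair_connected_of_adj hxl).preconnected
      (G.induce_singleton_connected (y l)).preconnected (v := x l) (by simp) rfl (hxy l)
  refine inducedMinor_butterfly_of_branchSets hC h.connA (G.induce_singleton_connected (x j))
    (G.induce_singleton_connected (y i)) h.connB ⟨?_, ?_, ?_, ?_⟩
    (by simp [h.xA]) (by simp [h.yB]) ?_
    ⟨x i, by simp, a, ha, hai⟩ ⟨x i, by simp, _, rfl, hxj⟩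
    ⟨x i, by simp, _, rfl, hxy i⟩ ⟨y l, by simp, b₂, hb₂, hbl⟩
    ⟨a₁, ha₁, _, rfl, haj.symm⟩ ⟨_, rfl, b, hb, hbi⟩ ?_
  · simp [h.xA, h.yA]
  · simp [h.xy, h.injX.eq_iff, hij.symm, hjl]
  · simp [(h.xy _ _).symm, h.injY.eq_iff, hil]
  · simp [h.xB, h.yB]
  · simp [h.disjAB, h.yA, h.xB, (h.xy _ _).symm]
  · rintro u (hu | rfl) v (rfl | hv)
    · exact h.antiAY u hu i
    · exact h.antiAB u hu v hv
    · simpa [h.adjXY] using hij.symm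
    · exact fun huv => h.antiBX v hv j huv.symm

theorem inducedMinor_butterfly {x y : Fin 3 → V} (h : IsEnumCreature G A B x y) :
    InducedMinor butterfly G := by
  by_contra hG
  have hX : ∀ i j l : Fin 3, i ≠ j → i ≠ l → j ≠ l → G.Adj (x i) (x j) → ¬ G.Adj (x i) (x l) :=
    fun _ _ _ hij hil hjl hj hl => hG (h.inducedMinor_butterfly_of_adj hij hil hjl hj hl)
  have hY : ∀ i j l : Fin 3, i ≠ j → i ≠ l → j ≠ l → G.Adj (y i) (y j) → ¬ G.Adj (y i) (y l) :=
    fun _ _ _ hij hil hjl hj hl => hG (h.symm.inducedMinor_butterfly_of_adj hij hil hjl hj hl)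
  have hN : ∀ i j l : Fin 3, i ≠ j → i ≠ l → j ≠ l → G.Adj (x j) (x l) ∨ G.Adj (y j) (y l) := by
    intro i j l hij hil hjl
    by_contra! hn
    exact hG (h.inducedMinor_butterfly_of_not_adj hij hil hjl hn.1 hn.2)
  have h01 := hN 2 0 1 (by decide) (by decide) (by decide)
  have h02 := hN 1 0 2 (by decide) (by decide) (by decide)
  have h12 := hN 0 1 2 (by decide) (by decide) (by decide)
  have hX0 := hX 0 1 2 (by decide) (by decide) (by decide)
  have hX1 := hX 1 0 2 (by decide) (by decide) (by decide)
  have hX2 := hX 2 0 1 (by decide) (by decide) (by decide)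
  have hY0 := hY 0 1 2 (by decide) (by decide) (by decide)
  have hY1 := hY 1 0 2 (by decide) (by decide) (by decide)
  have hY2 := hY 2 0 1 (by decide) (by decide) (by decide)
  rw [G.adj_comm (x 1) (x 0)] at hX1
  rw [G.adj_comm (x 2) (x 0), G.adj_comm (x 2) (x 1)] at hX2
  rw [G.adj_comm (y 1) (y 0)] at hY1
  rw [G.adj_comm (y 2) (y 0), G.adj_comm (y 2) (y 1)] at hY2
  tauto

end IsEnumCreature

theorem IsCreature.exists_isEnumCreature {V : Type} {G : SimpleGraph V} {k : ℕ}
    {A B X Y : Set V} (h : IsCreature G k A B X Y) :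
    ∃ x y : Fin k → V, IsEnumCreature G A B x y := by
  obtain ⟨-, -, hAB, hAX, hAY, hBX, hBY, hXY, hA, hB, aAB, aAY, aBX, eA, eB,
    x, y, hx, hy, rfl, rfl, hadj⟩ := h
  exact ⟨x, y,
    { connA := hA
      connB := hB
      disjAB := hAB
      xA := fun i => hAX.notMem_of_mem_right ⟨i, rfl⟩
      yA := fun i => hAY.notMem_of_mem_right ⟨i, rfl⟩
      xB := fun i => hBX.notMem_of_mem_right ⟨i, rfl⟩
      yB := fun i => hBY.notMem_of_mem_right ⟨i, rfl⟩
      xy := fun i j => hXY.ne_of_mem ⟨i, rfl⟩ ⟨j, rfl⟩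
      injX := hx
      injY := hy
      antiAB := aAB
      antiAY := fun a ha i => aAY a ha _ ⟨i, rfl⟩
      antiBX := fun b hb i => aBX b hb _ ⟨i, rfl⟩
      adjA := fun i => eA _ ⟨i, rfl⟩
      adjB := fun i => eB _ ⟨i, rfl⟩
      adjXY := hadj }⟩

theorem butterfly_induced_minor_free_creature_free {V : Type} [Fintype V]
    (G : SimpleGraph V) (h : ¬ InducedMinor butterfly G) :
    CreatureFree G 3 := by
  rintro ⟨A, B, X, Y, hc⟩
  obtain ⟨x, y, hxy⟩ := hc.exists_isEnumCreature
  exact h hxy.inducedMinor_butterfly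
end

section
/- The class of all finite simple graphs that do not contain the butterfly as an induced minor is tame. -/
open SimpleGraph

/-! ### Connected vertex sets -/

/-- The vertex set `X` induces a connected subgraph. -/
abbrev ConnectedSet {V : Type} (G : SimpleGraph V) (X : Set V) : Prop := (G.induce X).Connected

section ConnectedSet

variable {V : Type} {G : SimpleGraph V}

theorem connectedSet_singleton (v : V) : ConnectedSet G {v} := by
  have : Nonempty ({v} : Set V) := ⟨⟨v, rfl⟩⟩
  exact Connected.mk .of_subsingleton

theorem ConnectedSet.nonempty {X : Set V} (hX : ConnectedSet G X) : X.Nonempty :=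
  Set.nonempty_coe_sort.1 (SimpleGraph.Connected.nonempty hX)

theorem ConnectedSet.union_of_adj {X Y : Set V} (hX : ConnectedSet G X) (hY : ConnectedSet G Y)
    {x y : V} (hx : x ∈ X) (hy : y ∈ Y) (hxy : G.Adj x y) : ConnectedSet G (X ∪ Y) :=
  connected_induce_union hX.preconnected hY.preconnected hx hy hxy

theorem ConnectedSet.union_of_mem {X Y : Set V} (hX : ConnectedSet G X) (hY : ConnectedSet G Y)
    {x : V} (hx : x ∈ X) (hy : x ∈ Y) : ConnectedSet G (X ∪ Y) :=
  induce_union_connected hX.preconnected hY.preconnected ⟨x, hx, hy⟩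

theorem ConnectedSet.insert_of_adj {X : Set V} (hX : ConnectedSet G X) {x y : V} (hx : x ∈ X)
    (hxy : G.Adj x y) : ConnectedSet G (insert y X) := by
  rw [Set.insert_eq, Set.union_comm]
  exact hX.union_of_adj (connectedSet_singleton y) hx rfl hxy

/-- A connected set that is split by `W` contains an edge leaving `W`. -/
theorem ConnectedSet.exists_adj_of_mem_of_notMem {X W : Set V} (hX : ConnectedSet G X) {x z : V}
    (hx : x ∈ X) (hxW : x ∈ W) (hz : z ∈ X) (hzW : z ∉ W) :
    ∃ y ∈ X, y ∈ W ∧ ∃ q ∈ X, q ∉ W ∧ G.Adj y q := by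
  obtain ⟨p⟩ := hX.preconnected ⟨x, hx⟩ ⟨z, hz⟩
  obtain ⟨d, -, h1, h2⟩ := p.exists_boundary_dart {v | (v : V) ∈ W} hxW hzW
  exact ⟨d.fst, d.fst.2, h1, d.snd, d.snd.2, h2, d.adj⟩

theorem ConnectedSet.subset_of_closed {X W : Set V} (hX : ConnectedSet G X) {x : V} (hx : x ∈ X)
    (hxW : x ∈ W) (hW : ∀ y ∈ X, y ∈ W → ∀ z ∈ X, G.Adj y z → z ∈ W) : X ⊆ W := by
  intro z hz
  by_contra hzW
  obtain ⟨y, hy, hyW, q, hq, hqW, h⟩ := hX.exists_adj_of_mem_of_notMem hx hxW hz hzW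
  exact hqW (hW y hy hyW q hq h)

variable [Finite V]

/-- The component of `x` in the subgraph induced by `R`. -/
theorem exists_component {R : Set V} {x : V} (hx : x ∈ R) :
    ∃ W ⊆ R, ConnectedSet G W ∧ x ∈ W ∧ ∀ y ∈ W, ∀ z ∈ R, G.Adj y z → z ∈ W := by
  obtain ⟨W, hxW, ⟨hWR, hW⟩, hmax⟩ := Finite.exists_le_maximal
    (p := fun W : Set V => W ⊆ R ∧ ConnectedSet G W) (a := {x})
    ⟨Set.singleton_subset_iff.2 hx, connectedSet_singleton x⟩
  refine ⟨W, hWR, hW, hxW rfl, fun y hy z hz hyz => ?_⟩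
  exact hmax ⟨Set.insert_subset hz hWR, hW.insert_of_adj hy hyz⟩ (Set.subset_insert z W)
    (Set.mem_insert z W)

theorem ConnectedSet.exists_component_diff_singleton {X : Set V} (hX : ConnectedSet G X) {x z : V}
    (hx : x ∈ X) (hz : z ∈ X) (hxz : x ≠ z) :
    ∃ W ⊆ X \ {z}, ConnectedSet G W ∧ x ∈ W ∧ ∃ y ∈ W, G.Adj y z := by
  obtain ⟨W, hWR, hW, hxW, hcl⟩ := exists_component (G := G) (R := X \ {z}) ⟨hx, hxz⟩
  obtain ⟨y, -, hyW, q, hq, hqW, h⟩ :=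
    hX.exists_adj_of_mem_of_notMem hx hxW hz fun h => (hWR h).2 rfl
  have hqz : q = z := by
    by_contra hqz
    exact hqW (hcl y hyW q ⟨hq, hqz⟩ h)
  exact ⟨W, hWR, hW, hxW, y, hyW, hqz ▸ h⟩

/-- A connected set with at least two vertices has a non-cut vertex different from `r`. -/
theorem ConnectedSet.exists_diff_singleton {X : Set V} (hX : ConnectedSet G X) {r z : V}
    (hr : r ∈ X) (hz : z ∈ X) (hrz : r ≠ z) : ∃ v ∈ X, v ≠ r ∧ ConnectedSet G (X \ {v}) := by
  obtain ⟨W, hrW, ⟨hWX, hW⟩, hmax⟩ := Finite.exists_le_maximal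
    (p := fun W : Set V => W ⊂ X ∧ ConnectedSet G W) (a := {r})
    ⟨⟨Set.singleton_subset_iff.2 hr, fun h => hrz (h hz).symm⟩, connectedSet_singleton r⟩
  obtain ⟨z', hz', hzW⟩ := Set.exists_of_ssubset hWX
  obtain ⟨y, -, hyW, q, hq, hqW, h⟩ :=
    hX.exists_adj_of_mem_of_notMem hr (hrW rfl) hz' hzW
  have hins : insert q W = X := by
    by_contra hne
    exact hqW (hmax ⟨(Set.insert_subset hq hWX.1).ssubset_of_ne hne, hW.insert_of_adj hyW h⟩
      (Set.subset_insert q W) (Set.mem_insert q W))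
  refine ⟨q, hq, fun h => hqW (h ▸ hrW rfl), ?_⟩
  have : X \ {q} = W := by
    rw [← hins]
    simp [hqW]
  rwa [this]

/-- A connected set with at least three vertices has two vertices such that deleting either one,
or both, leaves a connected set. -/
theorem ConnectedSet.exists_diff_pair {X : Set V} (hX : ConnectedSet G X) {r z w : V}
    (hr : r ∈ X) (hz : z ∈ X) (hw : w ∈ X) (hrz : r ≠ z) (hrw : r ≠ w) (hzw : z ≠ w) :
    ∃ u ∈ X, ∃ v ∈ X, u ≠ v ∧ ConnectedSet G (X \ {u}) ∧ ConnectedSet G (X \ {v}) ∧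
      ConnectedSet G (X \ {u, v}) := by
  obtain ⟨u, hu, -, hXu⟩ := hX.exists_diff_singleton hr hz hrz
  obtain ⟨x', hx'⟩ := hXu.nonempty
  obtain ⟨u', -, hu', x, hx, hxu, hadj⟩ :=
    hX.exists_adj_of_mem_of_notMem (W := {u}) hu rfl hx'.1 hx'.2
  obtain rfl : u' = u := hu'
  obtain ⟨y, hy, hyx⟩ : ∃ y ∈ X \ {u'}, x ≠ y := by
    by_contra! hcon
    have h : ∀ t ∈ X, t = u' ∨ x = t := fun t ht => or_iff_not_imp_left.2 fun h => hcon t ⟨ht, h⟩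
    grind
  obtain ⟨v, hv, hvx, hXuv⟩ := hXu.exists_diff_singleton ⟨hx, hxu⟩ hy hyx
  rw [Set.sdiff_sdiff, Set.singleton_union] at hXuv
  refine ⟨u', hu, v, hv.1, fun h => hv.2 h.symm, hXu, ?_, hXuv⟩
  have := hXuv.insert_of_adj (x := x) ⟨hx, by grind⟩ hadj.symm
  convert this using 1
  ext t
  grind

end ConnectedSet

/-! ### Finding a butterfly -/

section Butterfly

variable {V : Type} {G : SimpleGraph V}

/-- Two anticomplete connected sets, each with two vertices having a neighbour in a third
connected set, yield a butterfly. -/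
theorem inducedMinor_butterfly [Finite V] {X A B : Set V} (hX : ConnectedSet G X)
    (hA : ConnectedSet G A) (hB : ConnectedSet G B) (hXA : ∀ x ∈ X, x ∉ A) (hXB : ∀ x ∈ X, x ∉ B)
    (hAB : ∀ a ∈ A, a ∉ B) (hanti : ∀ a ∈ A, ∀ b ∈ B, ¬ G.Adj a b)
    {a a' b b' x₁ x₂ x₃ x₄ : V} (ha : a ∈ A) (ha' : a' ∈ A) (haa' : a ≠ a')
    (hb : b ∈ B) (hb' : b' ∈ B) (hbb' : b ≠ b')
    (hx₁ : x₁ ∈ X) (h₁ : G.Adj x₁ a) (hx₂ : x₂ ∈ X) (h₂ : G.Adj x₂ a')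
    (hx₃ : x₃ ∈ X) (h₃ : G.Adj x₃ b) (hx₄ : x₄ ∈ X) (h₄ : G.Adj x₄ b') :
    InducedMinor butterfly G := by
  obtain ⟨A', hA'A, hA', haA', c, hcA', hc⟩ := hA.exists_component_diff_singleton ha ha' haa'
  obtain ⟨B', hB'B, hB', hbB', d, hdB', hd⟩ := hB.exists_component_diff_singleton hb hb' hbb'
  have hA'a : ∀ y ∈ A', y ∈ A ∧ y ≠ a' := fun y hy => hA'A hy
  have hB'b : ∀ y ∈ B', y ∈ B ∧ y ≠ b' := fun y hy => hB'B hy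
  refine ⟨![X, A', {a'}, B', {b'}], ?_, ?_, ?_, ?_, ?_⟩
  · intro w
    fin_cases w
    exacts [hX.nonempty, hA'.nonempty, Set.singleton_nonempty _, hB'.nonempty,
      Set.singleton_nonempty _]
  · intro w
    fin_cases w
    exacts [hX, hA', connectedSet_singleton a', hB', connectedSet_singleton b']
  · intro u w huw
    rw [Set.disjoint_left]
    fin_cases u <;> fin_cases w <;> simp at huw ⊢ <;> grind
  · intro u w huw
    fin_cases u <;> fin_cases w <;> simp [butterfly] at huw ⊢ <;> grind [G.adj_comm]
  · intro u w huw hadj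
    fin_cases u <;> fin_cases w <;> simp [butterfly] at huw hadj ⊢ <;> grind [G.adj_comm]

end Butterfly

/-! ### Full pairs -/

/-- `A` and `B` are disjoint connected sets, both with neighbourhood exactly `S`. -/
structure IsFullPair {V : Type} (G : SimpleGraph V) (S A B : Set V) : Prop where
  connected_left : ConnectedSet G A
  connected_right : ConnectedSet G B
  disjoint : ∀ a ∈ A, a ∉ B
  mem_iff_left : ∀ s, s ∈ S ↔ s ∉ A ∧ ∃ a ∈ A, G.Adj a s
  mem_iff_right : ∀ s, s ∈ S ↔ s ∉ B ∧ ∃ b ∈ B, G.Adj b s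

/-- At most one vertex of `A` has a neighbour in `K`. -/
def HasUniqueContact {V : Type} (G : SimpleGraph V) (K A : Set V) : Prop :=
  ∀ a ∈ A, ∀ a' ∈ A, ∀ k ∈ K, ∀ k' ∈ K, G.Adj k a → G.Adj k' a' → a = a'

/-- The vertices `s` of `S` such that every connected subset of `S` containing `s` has at most
one contact vertex in `A`. -/
def thinPart {V : Type} (G : SimpleGraph V) (S A : Set V) : Set V :=
  {s ∈ S | ∀ K ⊆ S, s ∈ K → ConnectedSet G K → HasUniqueContact G K A}

/-- The contact vertices in `A` of the thin part of `S`. -/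
def thinContacts {V : Type} (G : SimpleGraph V) (S A : Set V) : Set V :=
  {a ∈ A | ∃ s ∈ thinPart G S A, G.Adj s a}

section FullPair

variable {V : Type} {G : SimpleGraph V} {S A B : Set V}

theorem IsFullPair.symm (h : IsFullPair G S A B) : IsFullPair G S B A :=
  ⟨h.connected_right, h.connected_left, fun b hb ha => h.disjoint b ha hb, h.mem_iff_right,
    h.mem_iff_left⟩

theorem IsFullPair.not_adj (h : IsFullPair G S A B) : ∀ a ∈ A, ∀ b ∈ B, ¬ G.Adj a b := by
  intro a ha b hb hab
  by_cases hbA : b ∈ A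
  · exact h.disjoint b hbA hb
  · exact ((h.mem_iff_right b).1 ((h.mem_iff_left b).2 ⟨hbA, a, ha, hab⟩)).1 hb

theorem IsFullPair.notMem_left (h : IsFullPair G S A B) {s : V} (hs : s ∈ S) : s ∉ A :=
  ((h.mem_iff_left s).1 hs).1

theorem IsFullPair.notMem_right (h : IsFullPair G S A B) {s : V} (hs : s ∈ S) : s ∉ B :=
  ((h.mem_iff_right s).1 hs).1

theorem IsFullPair.exists_adj_left (h : IsFullPair G S A B) {s : V} (hs : s ∈ S) :
    ∃ a ∈ A, G.Adj s a :=
  let ⟨a, ha, hadj⟩ := ((h.mem_iff_left s).1 hs).2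
  ⟨a, ha, hadj.symm⟩

theorem IsFullPair.exists_adj_right (h : IsFullPair G S A B) {s : V} (hs : s ∈ S) :
    ∃ b ∈ B, G.Adj s b :=
  h.symm.exists_adj_left hs

theorem IsFullPair.mem_of_adj_of_adj (h : IsFullPair G S A B) {s a b : V} (ha : a ∈ A)
    (hb : b ∈ B) (has : G.Adj a s) (hbs : G.Adj b s) : s ∈ S :=
  (h.mem_iff_left s).2 ⟨fun hs => h.not_adj s hs b hb hbs.symm, a, ha, has⟩

theorem IsFullPair.mem_left_of_adj (h : IsFullPair G S A B) {a v : V} (ha : a ∈ A)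
    (hv : G.Adj a v) (hvS : v ∉ S) : v ∈ A := by
  by_contra hvA
  exact hvS ((h.mem_iff_left v).2 ⟨hvA, a, ha, hv⟩)

theorem eq_of_mem_thinPart {s a a' : V} (hs : s ∈ thinPart G S A) (ha : a ∈ A) (ha' : a' ∈ A)
    (h : G.Adj s a) (h' : G.Adj s a') : a = a' :=
  hs.2 {s} (Set.singleton_subset_iff.2 hs.1) rfl (connectedSet_singleton s) a ha a' ha' s rfl s rfl
    h h'

theorem not_adj_of_mem_thinPart {s s' a a' : V} (hs : s ∈ thinPart G S A)
    (hs' : s' ∈ thinPart G S A) (ha : a ∈ A) (ha' : a' ∈ A) (h : G.Adj s a) (h' : G.Adj s' a')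
    (hne : a ≠ a') : ¬ G.Adj s s' := fun hadj =>
  hne (hs.2 {s, s'} (Set.insert_subset hs.1 (Set.singleton_subset_iff.2 hs'.1)) (by simp)
    (induce_pair_connected_of_adj hadj) a ha a' ha' s (by simp) s' (by simp) h h')

variable [Finite V]

theorem IsFullPair.mem_thinPart_or (h : IsFullPair G S A B) (hG : ¬ InducedMinor butterfly G)
    {s : V} (hs : s ∈ S) : s ∈ thinPart G S A ∨ s ∈ thinPart G S B := by
  by_contra! hcon
  obtain ⟨h₁, h₂⟩ := hcon
  simp only [thinPart, HasUniqueContact, Set.mem_ofPred_eq, hs, true_and, not_forall] at h₁ h₂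
  obtain ⟨K, hKS, hsK, hK, a, ha, a', ha', k, hk, k', hk', hka, hka', haa'⟩ := h₁
  obtain ⟨L, hLS, hsL, hL, b, hb, b', hb', l, hl, l', hl', hlb, hlb', hbb'⟩ := h₂
  have hKL : ∀ x ∈ K ∪ L, x ∈ S := fun x hx => hx.elim (@hKS x) (@hLS x)
  exact hG (inducedMinor_butterfly (hK.union_of_mem hL hsK hsL) h.connected_left h.connected_right
    (fun x hx => h.notMem_left (hKL x hx)) (fun x hx => h.notMem_right (hKL x hx)) h.disjoint
    h.not_adj ha ha' haa' hb hb' hbb' (.inl hk) hka (.inl hk') hka' (.inr hl) hlb (.inr hl') hlb')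

/-- In a graph without a butterfly, the thin part of `S` has at most three contacts. -/
theorem IsFullPair.ncard_thinContacts_le (h : IsFullPair G S A B)
    (hG : ¬ InducedMinor butterfly G) : (thinContacts G S A).ncard ≤ 3 := by
  by_contra! hcard
  obtain ⟨A₀, -, hA₀⟩ := Set.Finite.exists_le_minimal
    (s := {X : Set V | thinContacts G S A ⊆ X ∧ X ⊆ A ∧ ConnectedSet G X}) (Set.toFinite _)
    (a := A) ⟨fun a ha => ha.1, subset_rfl, h.connected_left⟩
  obtain ⟨hCA₀, hA₀A, hconn⟩ := hA₀.prop
  have hmem : ∀ x ∈ A₀, ConnectedSet G (A₀ \ {x}) → x ∈ thinContacts G S A := by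
    intro x hx hx'
    by_contra hxC
    exact (hA₀.le_of_le (y := A₀ \ {x}) ⟨fun y hy => ⟨hCA₀ hy, fun hyx => hxC (hyx ▸ hy)⟩,
      Set.sdiff_subset.trans hA₀A, hx'⟩ Set.sdiff_subset hx).2 rfl
  obtain ⟨c₁, hc₁, c₂, hc₂, c₃, hc₃, h₁₂, h₁₃, h₂₃⟩ :=
    (Set.two_lt_ncard (Set.toFinite _)).1 (lt_trans (by norm_num) hcard)
  obtain ⟨u, hu, v, hv, huv, hu', hv', huv'⟩ :=
    hconn.exists_diff_pair (hCA₀ hc₁) (hCA₀ hc₂) (hCA₀ hc₃) h₁₂ h₁₃ h₂₃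
  obtain ⟨huA, su, hsu, hsuu⟩ := hmem u hu hu'
  obtain ⟨hvA, sv, hsv, hsvv⟩ := hmem v hv hv'
  obtain ⟨a₃, ⟨ha₃C, ha₃⟩, a₄, ⟨ha₄C, ha₄⟩, h₃₄⟩ :
      ∃ a ∈ thinContacts G S A \ {u, v}, ∃ a' ∈ thinContacts G S A \ {u, v}, a ≠ a' := by
    rw [← Set.one_lt_ncard (Set.toFinite _)]
    have := Set.le_ncard_sdiff {u, v} (thinContacts G S A)
    rw [Set.ncard_pair huv] at this
    omega
  have ha₃' : a₃ ∈ A₀ \ {u, v} := ⟨hCA₀ ha₃C, ha₃⟩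
  have ha₄' : a₄ ∈ A₀ \ {u, v} := ⟨hCA₀ ha₄C, ha₄⟩
  obtain ⟨ha₃A, s₃, hs₃, hsa₃⟩ := ha₃C
  obtain ⟨ha₄A, s₄, hs₄, hsa₄⟩ := ha₄C
  obtain ⟨bu, hbu, hsbu⟩ := h.exists_adj_right hsu.1
  obtain ⟨bv, hbv, hsbv⟩ := h.exists_adj_right hsv.1
  obtain ⟨b₃, hb₃, hsb₃⟩ := h.exists_adj_right hs₃.1
  obtain ⟨b₄, hb₄, hsb₄⟩ := h.exists_adj_right hs₄.1
  simp only [Set.mem_insert_iff, Set.mem_singleton_iff, not_or] at ha₃ ha₄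
  obtain ⟨u', hu'A, hu'u⟩ : ∃ x ∈ A₀ \ {u, v}, G.Adj x u := by
    obtain ⟨y, -, rfl, q, hq, hqu, hyq⟩ :=
      hv'.exists_adj_of_mem_of_notMem (W := {u}) (z := a₃) ⟨hu, huv⟩ rfl ⟨ha₃'.1, ha₃.2⟩ ha₃.1
    exact ⟨q, ⟨hq.1, by simpa using ⟨hqu, hq.2⟩⟩, hyq.symm⟩
  obtain ⟨v', hv'A, hv'v⟩ : ∃ x ∈ A₀ \ {u, v}, G.Adj x v := by
    obtain ⟨y, -, rfl, q, hq, hqv, hyq⟩ :=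
      hu'.exists_adj_of_mem_of_notMem (W := {v}) (z := a₃) ⟨hv, huv.symm⟩ rfl ⟨ha₃'.1, ha₃.1⟩ ha₃.2
    exact ⟨q, ⟨hq.1, by simpa using ⟨hq.2, hqv⟩⟩, hyq.symm⟩
  have hX := huv'.insert_of_adj ha₃' hsa₃.symm
  have hdisj := h.disjoint
  have hnadj := h.not_adj
  have hsuA := h.notMem_left hsu.1
  have hsvA := h.notMem_left hsv.1
  have hs₃A := h.notMem_left hs₃.1
  have hs₄A := h.notMem_left hs₄.1
  have hsuB := h.notMem_right hsu.1
  have hsvB := h.notMem_right hsv.1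
  have hs₃B := h.notMem_right hs₃.1
  have hs₄B := h.notMem_right hs₄.1
  apply hG
  by_cases hadj : G.Adj u v
  · have hs₃₄ : s₃ ≠ s₄ := by
      rintro rfl
      exact h₃₄ (eq_of_mem_thinPart hs₃ ha₃A ha₄A hsa₃ hsa₄)
    have hus₄ : ¬ G.Adj u s₄ := fun h' =>
      ha₄.1 (eq_of_mem_thinPart hs₄ ha₄A huA hsa₄ h'.symm)
    have hvs₄ : ¬ G.Adj v s₄ := fun h' =>
      ha₄.2 (eq_of_mem_thinPart hs₄ ha₄A hvA hsa₄ h'.symm)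
    refine inducedMinor_butterfly (a := u) (a' := v) (b := b₃) (b' := s₄) (x₃ := s₃) (x₄ := a₄)
      hX (induce_pair_connected_of_adj hadj)
      (h.connected_right.insert_of_adj hb₄ hsb₄.symm) ?_ ?_ ?_ ?_
      (by simp) (by simp) huv (.inr hb₃) (.inl rfl) (fun h => hs₄B (h ▸ hb₃)) (.inr hu'A) hu'u
      (.inr hv'A) hv'v (.inl rfl) hsb₃ (.inr ha₄') hsa₄.symm
    · rintro x (rfl | hx) (rfl | rfl)
      exacts [hs₃A huA, hs₃A hvA, hx.2 (by simp), hx.2 (by simp)]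
    · rintro x (rfl | hx) (rfl | hx')
      exacts [hs₃₄ rfl, hs₃B hx', hs₄A (hA₀A hx.1), hdisj x (hA₀A hx.1) hx']
    · rintro x (rfl | rfl) (rfl | hx')
      exacts [hs₄A huA, hdisj _ huA hx', hs₄A hvA, hdisj _ hvA hx']
    · rintro x (rfl | rfl) y (rfl | hy)
      exacts [hus₄, hnadj _ huA _ hy, hvs₄, hnadj _ hvA _ hy]
  · have hs₃u : s₃ ≠ su := by
      rintro rfl
      exact ha₃.1 (eq_of_mem_thinPart hs₃ ha₃A huA hsa₃ hsuu)
    have hs₃v : s₃ ≠ sv := by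
      rintro rfl
      exact ha₃.2 (eq_of_mem_thinPart hs₃ ha₃A hvA hsa₃ hsvv)
    have hsusv : su ≠ sv := by
      rintro rfl
      exact huv (eq_of_mem_thinPart hsu huA hvA hsuu hsvv)
    have husv : ¬ G.Adj u sv := fun h' => huv (eq_of_mem_thinPart hsv huA hvA h'.symm hsvv)
    have hvsu : ¬ G.Adj su v := fun h' => huv (eq_of_mem_thinPart hsu huA hvA hsuu h')
    have hss := not_adj_of_mem_thinPart hsu hsv huA hvA hsuu hsvv huv
    have hne : ∀ {a s}, a ∈ A → s ∉ A → a ≠ s := fun ha hs h => hs (h ▸ ha)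
    refine inducedMinor_butterfly (a := u) (a' := su) (b := v) (b' := sv)
      (hX.union_of_adj h.connected_right (.inl rfl) hb₃ hsb₃)
      (induce_pair_connected_of_adj hsuu.symm) (induce_pair_connected_of_adj hsvv.symm) ?_ ?_ ?_ ?_
      (by simp) (by simp) (hne huA hsuA) (by simp) (by simp) (hne hvA hsvA)
      (.inl (.inr hu'A)) hu'u (.inr hbu) hsbu.symm (.inl (.inr hv'A)) hv'v (.inr hbv) hsbv.symm
    · rintro x ((rfl | hx) | hx) (rfl | rfl)
      exacts [hs₃A huA, hs₃u rfl, hx.2 (by simp), hsuA (hA₀A hx.1), hdisj _ huA hx, hsuB hx]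
    · rintro x ((rfl | hx) | hx) (rfl | rfl)
      exacts [hs₃A hvA, hs₃v rfl, hx.2 (by simp), hsvA (hA₀A hx.1), hdisj _ hvA hx, hsvB hx]
    · rintro x (rfl | rfl) (rfl | rfl)
      exacts [huv rfl, hsvA huA, hsuA hvA, hsusv rfl]
    · rintro x (rfl | rfl) y (rfl | rfl)
      exacts [hadj, husv, hvsu, hss]

end FullPair

/-! ### Guarded pairs -/

/-- A full pair together with guards `P ⊆ A` and `Q ⊆ B`: every vertex of `S` without a neighbour
in one guard has its only neighbour on the opposite side in the other guard. -/
structure Guarded {V : Type} (G : SimpleGraph V) (P Q S A B : Set V) : Prop where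
  isFullPair : IsFullPair G S A B
  left_subset : P ⊆ A
  right_subset : Q ⊆ B
  left_nonempty : P.Nonempty
  right_nonempty : Q.Nonempty
  left : ∀ s ∈ S, (∀ q ∈ Q, ¬ G.Adj s q) → ∃ p ∈ P, ∀ a ∈ A, G.Adj s a → a = p
  right : ∀ s ∈ S, (∀ p ∈ P, ¬ G.Adj s p) → ∃ q ∈ Q, ∀ b ∈ B, G.Adj s b → b = q

/-- `t` has a neighbour in `B` that is adjacent to `b`. -/
def NearContact {V : Type} (G : SimpleGraph V) (B : Set V) (t b : V) : Prop :=
  ∃ q ∈ B, G.Adj t q ∧ G.Adj q b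

/-- `t` reaches a neighbour of `b` through a connected subset of `B` that avoids the closed
neighbourhood of `Q`. -/
def FarContact {V : Type} (G : SimpleGraph V) (Q B : Set V) (t b : V) : Prop :=
  ∃ W ⊆ B, ConnectedSet G W ∧ (∃ x ∈ W, G.Adj t x) ∧ (∀ w ∈ W, w ∉ Q ∧ ∀ q ∈ Q, ¬ G.Adj w q) ∧
    ∃ y ∈ W, ∃ q, G.Adj y q ∧ G.Adj q b

/-- Every `t ∈ T` is the only element of `T` in its guarded set `S t`, and no element of `T` has a
neighbour in `Q`. -/
structure PrivateFamily {V : Type} (G : SimpleGraph V) (P Q T : Set V) (S A B : V → Set V) :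
    Prop where
  guarded : ∀ t ∈ T, Guarded G P Q (S t) (A t) (B t)
  mem : ∀ t ∈ T, t ∈ S t
  eq_of_mem : ∀ t ∈ T, ∀ t' ∈ T, t' ∈ S t → t' = t
  not_adj_right : ∀ t ∈ T, ∀ q ∈ Q, ¬ G.Adj t q

section Guarded

variable {V : Type} {G : SimpleGraph V} {P Q : Set V}

theorem Guarded.symm {S A B : Set V} (h : Guarded G P Q S A B) : Guarded G Q P S B A :=
  ⟨h.isFullPair.symm, h.right_subset, h.left_subset, h.right_nonempty, h.left_nonempty, h.right,
    h.left⟩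

theorem Guarded.exists_left {S A B : Set V} (h : Guarded G P Q S A B) {s : V} (hs : s ∈ S)
    (hsQ : ∀ q ∈ Q, ¬ G.Adj s q) : ∃ p ∈ P, G.Adj s p ∧ ∀ a ∈ A, G.Adj s a → a = p := by
  obtain ⟨p, hp, huniq⟩ := h.left s hs hsQ
  obtain ⟨a, ha, hsa⟩ := h.isFullPair.exists_adj_left hs
  exact ⟨p, hp, huniq a ha hsa ▸ hsa, huniq⟩

/-- A small guard on each side exists in graphs without a butterfly. -/
theorem IsFullPair.exists_guarded [Finite V] {S A B : Set V} (h : IsFullPair G S A B)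
    (hG : ¬ InducedMinor butterfly G) :
    ∃ P Q : Set V, P.ncard ≤ 4 ∧ Q.ncard ≤ 4 ∧ Guarded G P Q S A B := by
  have key : ∀ {A B : Set V}, IsFullPair G S A B → ∀ a b, ∀ s ∈ S,
      (∀ q ∈ insert b (thinContacts G S B), ¬ G.Adj s q) →
      ∃ p ∈ insert a (thinContacts G S A), ∀ a ∈ A, G.Adj s a → a = p := by
    intro A B h a b s hs hsQ
    rcases h.mem_thinPart_or hG hs with hsA | hsB
    · obtain ⟨p, hp, hsp⟩ := h.exists_adj_left hs
      exact ⟨p, .inr ⟨hp, s, hsA, hsp⟩, fun a ha hsa => eq_of_mem_thinPart hsA ha hp hsa hsp⟩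
    · obtain ⟨q, hq, hsq⟩ := h.exists_adj_right hs
      exact (hsQ q (.inr ⟨hq, s, hsB, hsq⟩) hsq).elim
  obtain ⟨a, ha⟩ := h.connected_left.nonempty
  obtain ⟨b, hb⟩ := h.connected_right.nonempty
  refine ⟨insert a (thinContacts G S A), insert b (thinContacts G S B), ?_, ?_, h,
    Set.insert_subset ha fun _ h => h.1, Set.insert_subset hb fun _ h => h.1,
    Set.insert_nonempty _ _, Set.insert_nonempty _ _, key h a b, key h.symm b a⟩
  · exact (Set.ncard_insert_le _ _).trans (Nat.succ_le_succ (h.ncard_thinContacts_le hG))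
  · exact (Set.ncard_insert_le _ _).trans (Nat.succ_le_succ (h.symm.ncard_thinContacts_le hG))

namespace PrivateFamily

variable {T : Set V} {S A B : V → Set V} (h : PrivateFamily G P Q T S A B) {t t' : V}
include h

theorem exists_left (ht : t ∈ T) : ∃ p ∈ P, G.Adj t p ∧ ∀ a ∈ A t, G.Adj t a → a = p :=
  (h.guarded t ht).exists_left (h.mem t ht) (h.not_adj_right t ht)

theorem mem_left (ht : t ∈ T) (ht' : t' ∈ T) (hne : t ≠ t') : t' ∈ A t := by
  obtain ⟨p, hp, hadj, -⟩ := h.exists_left ht'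
  exact (h.guarded t ht).isFullPair.mem_left_of_adj ((h.guarded t ht).left_subset hp) hadj.symm
    fun hmem => hne (h.eq_of_mem t ht t' ht' hmem).symm

theorem notMem_right (ht : t ∈ T) (ht' : t' ∈ T) : t' ∉ B t := by
  by_cases hne : t = t'
  · subst hne
    exact (h.guarded t ht).isFullPair.notMem_right (h.mem t ht)
  · exact (h.guarded t ht).isFullPair.disjoint _ (h.mem_left ht ht' hne)

theorem not_adj (ht : t ∈ T) (ht' : t' ∈ T) (hne : t ≠ t') : ¬ G.Adj t t' := by
  intro hadj
  obtain ⟨p, hp, -, huniq⟩ := h.exists_left ht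
  obtain rfl := huniq t' (h.mem_left ht ht' hne) hadj
  exact (h.guarded t' ht').isFullPair.notMem_left (h.mem t' ht') ((h.guarded t' ht').left_subset hp)

theorem not_adj_of_mem_right (ht : t ∈ T) (ht' : t' ∈ T) (hne : t ≠ t') {q : V} (hq : q ∈ B t) :
    ¬ G.Adj t' q :=
  (h.guarded t ht).isFullPair.not_adj _ (h.mem_left ht ht' hne) q hq

theorem near_not_adj (ht : t ∈ T) (ht' : t' ∈ T) (hne : t ≠ t') {q q' b : V} (hb : b ∈ Q)
    (hq : q ∈ B t) (htq : G.Adj t q) (hq' : q' ∈ B t') (htq' : G.Adj t' q') (hqb' : G.Adj q' b) :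
    ¬ G.Adj q q' := by
  intro hadj
  have hg := h.guarded t ht
  have hg' := h.guarded t' ht'
  have hq'S : q' ∈ S t := hg.isFullPair.mem_of_adj_of_adj (h.mem_left ht ht' hne)
    (hg.right_subset hb) htq' hqb'.symm
  obtain ⟨r, hr, -, huniq⟩ := hg.symm.exists_left hq'S fun p hp hadj' =>
    hg'.isFullPair.not_adj p (hg'.left_subset hp) q' hq' hadj'.symm
  exact h.not_adj_right t ht q (huniq q hq hadj.symm ▸ hr) htq

theorem far_notMem (ht : t ∈ T) (ht' : t' ∈ T) (hne : t ≠ t') {W : Set V} (hWB : W ⊆ B t')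
    (hW : ConnectedSet G W) (hx : ∃ x ∈ W, G.Adj t' x)
    (hWQ : ∀ w ∈ W, w ∉ Q ∧ ∀ q ∈ Q, ¬ G.Adj w q) {w : V} (hw : w ∈ W) :
    w ∉ B t ∧ ∀ y ∈ B t, ¬ G.Adj y w := by
  have hg := h.guarded t ht
  have hg' := h.guarded t' ht'
  have hWS : ∀ w ∈ W, w ∉ S t := by
    intro w hw hwS
    obtain ⟨p, hp, hadj, -⟩ := hg.exists_left hwS (hWQ w hw).2
    exact hg'.isFullPair.not_adj p (hg'.left_subset hp) w (hWB hw) hadj.symm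
  have hwB : w ∉ B t := by
    intro hwB
    have hsub := hW.subset_of_closed hw hwB fun y _ hy z hz hyz =>
      hg.isFullPair.symm.mem_left_of_adj hy hyz (hWS z hz)
    obtain ⟨x, hx, hadj⟩ := hx
    exact h.not_adj_of_mem_right ht ht' hne (hsub hx) hadj
  exact ⟨hwB, fun y hy hadj => hwB (hg.isFullPair.symm.mem_left_of_adj hy hadj (hWS w hw))⟩

variable [Finite V]

theorem near_or_far (ht : t ∈ T) :
    ∃ b ∈ Q, NearContact G (B t) t b ∨ FarContact G Q (B t) t b := by
  have hg := h.guarded t ht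
  by_cases hnear : ∃ b ∈ Q, NearContact G (B t) t b
  · obtain ⟨b, hb, hb'⟩ := hnear
    exact ⟨b, hb, .inl hb'⟩
  obtain ⟨x, hx, htx⟩ := hg.isFullPair.exists_adj_right (h.mem t ht)
  have hxR : x ∈ {w ∈ B t | w ∉ Q ∧ ∀ q ∈ Q, ¬ G.Adj w q} :=
    ⟨hx, fun hxQ => h.not_adj_right t ht x hxQ htx,
      fun q hq hadj => hnear ⟨q, hq, x, hx, htx, hadj⟩⟩
  obtain ⟨W, hWR, hW, hxW, hcl⟩ := exists_component (G := G) hxR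
  obtain ⟨z, hz⟩ := hg.right_nonempty
  obtain ⟨y, -, hyW, q, hqB, hqW, hyq⟩ := hg.isFullPair.connected_right.exists_adj_of_mem_of_notMem
    hx hxW (hg.right_subset hz) fun hzW => (hWR hzW).2.1 hz
  obtain ⟨b, hb, hqb⟩ : ∃ b ∈ Q, G.Adj q b := by
    by_contra! hcon
    exact hqW (hcl y hyW q ⟨hqB, fun hqQ => (hWR hyW).2.2 q hqQ hyq, hcon⟩ hyq)
  exact ⟨b, hb, .inr ⟨W, fun w hw => (hWR hw).1, hW, ⟨x, hxW, htx⟩, fun w hw => (hWR hw).2,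
    y, hyW, q, hyq, hqb⟩⟩

theorem inducedMinor_of_near {t₁ t₂ t₃ a b : V} (h₁ : t₁ ∈ T) (h₂ : t₂ ∈ T) (h₃ : t₃ ∈ T)
    (h₁₂ : t₁ ≠ t₂) (h₁₃ : t₁ ≠ t₃) (h₂₃ : t₂ ≠ t₃) (ha : a ∈ P) (hb : b ∈ Q)
    (ha₁ : G.Adj t₁ a) (ha₂ : G.Adj t₂ a) (ha₃ : G.Adj t₃ a) (hb₁ : NearContact G (B t₁) t₁ b)
    (hb₂ : NearContact G (B t₂) t₂ b) (hb₃ : NearContact G (B t₃) t₃ b) :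
    InducedMinor butterfly G := by
  obtain ⟨q₁, hq₁, htq₁, hqb₁⟩ := hb₁
  obtain ⟨q₂, hq₂, htq₂, hqb₂⟩ := hb₂
  obtain ⟨q₃, hq₃, htq₃, hqb₃⟩ := hb₃
  have hX := (((connectedSet_singleton a).insert_of_adj rfl ha₃.symm).insert_of_adj (.inl rfl)
    htq₃).insert_of_adj (.inl rfl) hqb₃
  have hbt : ∀ t ∈ T, b ≠ t := by
    rintro t ht rfl
    exact h.notMem_right ht ht ((h.guarded b ht).right_subset hb)
  have hqt : ∀ {t t' q}, t ∈ T → t' ∈ T → q ∈ B t → q ≠ t' := by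
    rintro t t' q ht ht' hq rfl
    exact h.notMem_right ht ht' hq
  have hqq : ∀ {t t' q q'}, t ∈ T → t' ∈ T → t ≠ t' → q ∈ B t → G.Adj t' q' → q ≠ q' := by
    rintro t t' q q' ht ht' hne hq htq' rfl
    exact h.not_adj_of_mem_right ht ht' hne hq htq'
  have haq : ∀ {t q}, t ∈ T → q ∈ B t → a ≠ q := by
    rintro t q ht hq rfl
    exact (h.guarded t ht).isFullPair.disjoint _ ((h.guarded t ht).left_subset ha) hq
  have hXt : ∀ {t q}, t ∈ T → t ≠ t₃ → G.Adj t a → q ∈ B t → G.Adj t q → G.Adj q b →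
      ∀ x ∈ (insert b (insert q₃ (insert t₃ {a})) : Set V), x ∉ ({t, q} : Set V) := by
    rintro t q ht hne hta hq htq hqb x (rfl | rfl | rfl | rfl) (rfl | rfl)
    exacts [hbt _ ht rfl, hqb.ne rfl, hqt h₃ ht hq₃ rfl, hqq h₃ ht hne.symm hq₃ htq rfl, hne rfl,
      hqt ht h₃ hq rfl, hta.ne rfl, haq ht hq rfl]
  refine inducedMinor_butterfly hX (induce_pair_connected_of_adj htq₁)
    (induce_pair_connected_of_adj htq₂) (hXt h₁ h₁₃ ha₁ hq₁ htq₁ hqb₁)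
    (hXt h₂ h₂₃ ha₂ hq₂ htq₂ hqb₂) ?_ ?_ (by simp) (by simp) htq₁.ne (by simp) (by simp) htq₂.ne
    (.inr (.inr (.inr rfl))) ha₁.symm (.inl rfl) hqb₁.symm (.inr (.inr (.inr rfl))) ha₂.symm
    (.inl rfl) hqb₂.symm
  · rintro x (rfl | rfl) (rfl | rfl)
    exacts [h₁₂ rfl, hqt h₂ h₁ hq₂ rfl, hqt h₁ h₂ hq₁ rfl, hqq h₁ h₂ h₁₂ hq₁ htq₂ rfl]
  · rintro x (rfl | rfl) y (rfl | rfl)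
    exacts [h.not_adj h₁ h₂ h₁₂, h.not_adj_of_mem_right h₂ h₁ h₁₂.symm hq₂,
      fun hadj => h.not_adj_of_mem_right h₁ h₂ h₁₂ hq₁ hadj.symm,
      h.near_not_adj h₁ h₂ h₁₂ hb hq₁ htq₁ hq₂ htq₂ hqb₂]

theorem inducedMinor_of_far {t₁ t₂ t₃ a b : V} (h₁ : t₁ ∈ T) (h₂ : t₂ ∈ T) (h₃ : t₃ ∈ T)
    (h₁₂ : t₁ ≠ t₂) (h₁₃ : t₁ ≠ t₃) (h₂₃ : t₂ ≠ t₃) (ha : a ∈ P) (hb : b ∈ Q)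
    (ha₁ : G.Adj t₁ a) (ha₂ : G.Adj t₂ a) (ha₃ : G.Adj t₃ a) (hb₁ : FarContact G Q (B t₁) t₁ b)
    (hb₂ : FarContact G Q (B t₂) t₂ b) (hb₃ : FarContact G Q (B t₃) t₃ b) :
    InducedMinor butterfly G := by
  obtain ⟨W₁, hWB₁, hW₁, hx₁, hWQ₁, y₁, hy₁, q₁, hyq₁, hqb₁⟩ := hb₁
  obtain ⟨W₂, hWB₂, hW₂, hx₂, hWQ₂, y₂, hy₂, q₂, hyq₂, hqb₂⟩ := hb₂
  obtain ⟨W₃, hWB₃, hW₃, hx₃, hWQ₃, y₃, hy₃, q₃, hyq₃, hqb₃⟩ := hb₃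
  obtain ⟨x₁, hx₁W, htx₁⟩ := id hx₁
  obtain ⟨x₂, hx₂W, htx₂⟩ := id hx₂
  obtain ⟨x₃, hx₃W, htx₃⟩ := id hx₃
  have hX := (((((hW₃.insert_of_adj hx₃W htx₃.symm).insert_of_adj (.inl rfl) ha₃).insert_of_adj
    (.inr (.inr hy₃)) hyq₃).insert_of_adj (.inl rfl) hqb₃).insert_of_adj (.inl rfl)
    hqb₁.symm).insert_of_adj (.inr (.inl rfl)) hqb₂.symm
  have hbt : ∀ t ∈ T, b ≠ t := by
    rintro t ht rfl
    exact h.notMem_right ht ht ((h.guarded b ht).right_subset hb)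
  have hqt : ∀ {t q}, t ∈ T → G.Adj q b → q ≠ t := by
    rintro t q ht hqb rfl
    exact h.not_adj_right _ ht b hb hqb
  have hXt : ∀ {t W}, t ∈ T → t ≠ t₃ → G.Adj t a → W ⊆ B t →
      (∀ w ∈ W, w ∉ Q ∧ ∀ q ∈ Q, ¬ G.Adj w q) →
      ∀ x ∈ insert q₂ (insert q₁ (insert b (insert q₃ (insert a (insert t₃ W₃))))),
        x ∉ insert t W := by
    rintro t W ht hne hta hWB hWQ x (rfl | rfl | rfl | rfl | rfl | rfl | hx) (rfl | hx')
    exacts [hqt ht hqb₂ rfl, (hWQ _ hx').2 b hb hqb₂, hqt ht hqb₁ rfl, (hWQ _ hx').2 b hb hqb₁,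
      hbt _ ht rfl, (hWQ _ hx').1 hb, hqt ht hqb₃ rfl, (hWQ _ hx').2 b hb hqb₃, hta.ne rfl,
      (h.guarded t ht).isFullPair.disjoint _ ((h.guarded t ht).left_subset ha) (hWB hx'),
      hne rfl, h.notMem_right ht h₃ (hWB hx'), h.notMem_right h₃ ht (hWB₃ hx),
      (h.far_notMem ht h₃ hne hWB₃ hW₃ hx₃ hWQ₃ hx).1 (hWB hx')]
  have hty : ∀ {t y}, t ∈ T → y ∈ B t → t ≠ y := by
    rintro t y ht hy rfl
    exact h.notMem_right ht ht hy
  refine inducedMinor_butterfly hX (hW₁.insert_of_adj hx₁W htx₁.symm)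
    (hW₂.insert_of_adj hx₂W htx₂.symm) (hXt h₁ h₁₃ ha₁ hWB₁ hWQ₁) (hXt h₂ h₂₃ ha₂ hWB₂ hWQ₂) ?_ ?_
    (.inl rfl) (.inr hy₁) (hty h₁ (hWB₁ hy₁)) (.inl rfl) (.inr hy₂) (hty h₂ (hWB₂ hy₂))
    (by simp) ha₁.symm (.inr (.inl rfl)) hyq₁.symm (by simp) ha₂.symm (.inl rfl) hyq₂.symm
  · rintro x (rfl | hx) (rfl | hx')
    exacts [h₁₂ rfl, h.notMem_right h₂ h₁ (hWB₂ hx'), h.notMem_right h₁ h₂ (hWB₁ hx),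
      (h.far_notMem h₁ h₂ h₁₂ hWB₂ hW₂ hx₂ hWQ₂ hx').1 (hWB₁ hx)]
  · rintro x (rfl | hx) y (rfl | hy)
    exacts [h.not_adj h₁ h₂ h₁₂, h.not_adj_of_mem_right h₂ h₁ h₁₂.symm (hWB₂ hy),
      fun hadj => h.not_adj_of_mem_right h₁ h₂ h₁₂ (hWB₁ hx) hadj.symm,
      (h.far_notMem h₁ h₂ h₁₂ hWB₂ hW₂ hx₂ hWQ₂ hy).2 _ (hWB₁ hx)]

end PrivateFamily

open Classical in
/-- In a graph without a butterfly, private families with small guards are small. -/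
theorem PrivateFamily.card_le [Finite V] {P Q T : Finset V} {S A B : V → Set V}
    (h : PrivateFamily G (P : Set V) (Q : Set V) (T : Set V) S A B)
    (hG : ¬ InducedMinor butterfly G) (hP : P.card ≤ 4) (hQ : Q.card ≤ 4) : T.card ≤ 64 := by
  by_contra! hT
  have hcol : ∀ t ∈ T, ∃ c ∈ (P ×ˢ Q) ×ˢ (Finset.univ : Finset Bool), G.Adj t c.1.1 ∧
      bif c.2 then NearContact G (B t) t c.1.2 else FarContact G Q (B t) t c.1.2 := by
    intro t ht
    obtain ⟨p, hp, htp, -⟩ := h.exists_left ht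
    obtain ⟨b, hb, hb' | hb'⟩ := h.near_or_far ht
    · exact ⟨((p, b), true), by simpa using ⟨hp, hb⟩, htp, hb'⟩
    · exact ⟨((p, b), false), by simpa using ⟨hp, hb⟩, htp, hb'⟩
  choose! c hc hcadj hctype using hcol
  have hcard : ((P ×ˢ Q) ×ˢ (Finset.univ : Finset Bool)).card * 2 < T.card := by
    have := Nat.mul_le_mul hP hQ
    simp only [Finset.card_product, Finset.card_univ, Fintype.card_bool]
    omega
  obtain ⟨⟨⟨a, b⟩, k⟩, hk, hlt⟩ := Finset.exists_lt_card_fiber_of_mul_lt_card_of_maps_to hc hcard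
  obtain ⟨t₁, h₁, t₂, h₂, t₃, h₃, h₁₂, h₁₃, h₂₃⟩ := Finset.two_lt_card.1 hlt
  simp only [Finset.mem_product, Finset.mem_univ, and_true, Finset.mem_filter] at hk h₁ h₂ h₃
  have a₁ := hcadj t₁ h₁.1
  have a₂ := hcadj t₂ h₂.1
  have a₃ := hcadj t₃ h₃.1
  have b₁ := hctype t₁ h₁.1
  have b₂ := hctype t₂ h₂.1
  have b₃ := hctype t₃ h₃.1
  rw [h₁.2] at a₁ b₁
  rw [h₂.2] at a₂ b₂
  rw [h₃.2] at a₃ b₃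
  cases k
  · exact hG (h.inducedMinor_of_far h₁.1 h₂.1 h₃.1 h₁₂ h₁₃ h₂₃ hk.1 hk.2 a₁ a₂ a₃ b₁ b₂ b₃)
  · exact hG (h.inducedMinor_of_near h₁.1 h₂.1 h₃.1 h₁₂ h₁₃ h₂₃ hk.1 hk.2 a₁ a₂ a₃ b₁ b₂ b₃)

end Guarded

/-! ### Minimal separators and full pairs -/

section MinimalSeparator

variable {V : Type} {G : SimpleGraph V} {S : Set V} {a b : V}

theorem Separates.symm (h : Separates G S a b) : Separates G S b a := by
  intro p
  simpa using h p.reverse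

theorem ConnectedSet.not_separates {X : Set V} (hX : ConnectedSet G X) (ha : a ∈ X) (hb : b ∈ X)
    (hXS : ∀ x ∈ X, x ∉ S) : ¬ Separates G S a b := by
  intro h
  obtain ⟨p⟩ := hX.preconnected ⟨a, ha⟩ ⟨b, hb⟩
  obtain ⟨x, hx, hxS⟩ := h (p.map (Embedding.induce X).toHom)
  obtain ⟨y, -, rfl⟩ := List.mem_map.1 (Walk.support_map _ p ▸ hx)
  exact hXS y y.2 hxS

/-- The component of `a` in the complement of a set that separates `a` from `b` and is minimal with
this property has neighbourhood `S`. -/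
theorem mem_iff_of_minimal_separates {A : Set V} (hmin : ∀ S' ⊂ S, ¬ Separates G S' a b)
    (hAS : A ⊆ Sᶜ) (haA : a ∈ A) (hbA : b ∉ A) (hA : ∀ y ∈ A, ∀ z ∈ Sᶜ, G.Adj y z → z ∈ A) (s : V) :
    s ∈ S ↔ s ∉ A ∧ ∃ x ∈ A, G.Adj x s := by
  refine ⟨fun hs => ⟨fun hsA => hAS hsA hs, ?_⟩, fun ⟨hsA, x, hx, hadj⟩ => ?_⟩
  · obtain ⟨p, hp⟩ := not_forall.1 (hmin (S \ {s}) (Set.sdiff_singleton_ssubset.2 hs))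
    obtain ⟨d, hd, hd₁, hd₂⟩ := p.exists_boundary_dart A haA hbA
    have hdS : d.snd ∈ S := by
      by_contra hdS
      exact hd₂ (hA _ hd₁ _ hdS d.adj)
    obtain rfl : d.snd = s := by
      by_contra hne
      exact hp ⟨d.snd, p.dart_snd_mem_support_of_mem_darts hd, hdS, hne⟩
    exact ⟨d.fst, hd₁, d.adj⟩
  · by_contra hs
    exact hsA (hA x hx s hs hadj)

theorem IsMinimalSeparator.exists_isFullPair [Finite V] (h : IsMinimalSeparator G S) :
    ∃ A B : Set V, IsFullPair G S A B := by
  obtain ⟨a, b, ha, hb, -, -, hsep, hmin⟩ := h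
  obtain ⟨A, hAS, hA, haA, hAcl⟩ := exists_component (G := G) (R := Sᶜ) ha
  obtain ⟨B, hBS, hB, hbB, hBcl⟩ := exists_component (G := G) (R := Sᶜ) hb
  have hdisj : ∀ x ∈ A, x ∉ B := fun x hx hx' =>
    (hA.union_of_mem hB hx hx').not_separates (.inl haA) (.inr hbB)
      (fun y hy => hy.elim (@hAS y) (@hBS y)) hsep
  exact ⟨A, B, hA, hB, hdisj,
    mem_iff_of_minimal_separates hmin hAS haA (fun hbA => hdisj b hbA hbB) hAcl,
    mem_iff_of_minimal_separates (fun S' hS' h => hmin S' hS' h.symm) hBS hbB (hdisj a haA) hBcl⟩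

end MinimalSeparator

/-! ### Counting -/

section Counting

variable {V : Type} [Fintype V] {G : SimpleGraph V}

open Classical in
/-- The vertex sets with at most `k` elements. -/
noncomputable def smallSets (V : Type) [Fintype V] (k : ℕ) : Finset (Finset V) :=
  {T | T.card ≤ k}

theorem mem_smallSets {k : ℕ} {T : Finset V} : T ∈ smallSets V k ↔ T.card ≤ k := by
  simp [smallSets]

theorem card_smallSets_le (k : ℕ) : (smallSets V k).card ≤ (Fintype.card V + 1) ^ k := by
  classical
  have hsub : smallSets V k ⊆
      Finset.univ.image fun f : Fin k → Option V => (Finset.univ.image f).eraseNone := by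
    intro T hT
    rw [mem_smallSets] at hT
    refine Finset.mem_image.2 ⟨fun i => T.toList[i.val]?, Finset.mem_univ _, ?_⟩
    ext x
    simp only [Finset.mem_eraseNone, Finset.mem_image, Finset.mem_univ, true_and]
    rw [← Finset.mem_toList, List.mem_iff_getElem?]
    refine ⟨fun ⟨i, hi⟩ => ⟨i, hi⟩, fun ⟨i, hi⟩ => ⟨⟨i, ?_⟩, hi⟩⟩
    have := (List.getElem?_eq_some_iff.1 hi).1
    rw [Finset.length_toList] at this
    omega
  refine (Finset.card_le_card hsub).trans (Finset.card_image_le.trans ?_)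
  simp

open Classical in
/-- The sets guarded by `P` and `Q`. -/
noncomputable def guardedSets (G : SimpleGraph V) (P Q : Finset V) : Finset (Finset V) :=
  {S | ∃ A B : Set V, Guarded G P Q S A B}

theorem mem_guardedSets {P Q S : Finset V} :
    S ∈ guardedSets G P Q ↔ ∃ A B : Set V, Guarded G P Q S A B := by
  simp [guardedSets]

theorem guardedSets_comm (P Q : Finset V) : guardedSets G P Q = guardedSets G Q P := by
  ext S
  simp only [mem_guardedSets]
  exact ⟨fun ⟨A, B, h⟩ => ⟨B, A, h.symm⟩, fun ⟨A, B, h⟩ => ⟨B, A, h.symm⟩⟩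

open Classical in
/-- The vertices of `S` without a neighbour in `Q`. -/
noncomputable def awayPart (G : SimpleGraph V) (Q S : Finset V) : Finset V :=
  {s ∈ S | ∀ q ∈ Q, ¬ G.Adj s q}

theorem mem_awayPart {Q S : Finset V} {s : V} :
    s ∈ awayPart G Q S ↔ s ∈ S ∧ ∀ q ∈ Q, ¬ G.Adj s q := by
  simp [awayPart]

open Classical in
theorem card_image_awayPart_le (hG : ¬ InducedMinor butterfly G) {P Q : Finset V}
    (hP : P.card ≤ 4) (hQ : Q.card ≤ 4) :
    ((guardedSets G P Q).image (awayPart G Q)).card ≤ (Fintype.card V + 1) ^ 64 := by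
  refine (Finset.card_le_card_shatterer _).trans
    ((Finset.card_le_card fun T hT => ?_).trans (card_smallSets_le 64))
  rw [Finset.mem_shatterer] at hT
  rw [mem_smallSets]
  have hex : ∀ U ⊆ T, ∃ (S : Finset V) (A B : Set V), Guarded G P Q S A B ∧ T ∩ awayPart G Q S = U := by
    intro U hU
    obtain ⟨_, hu, hTU⟩ := hT hU
    obtain ⟨S, hS, rfl⟩ := Finset.mem_image.1 hu
    obtain ⟨A, B, hg⟩ := mem_guardedSets.1 hS
    exact ⟨S, A, B, hg, hTU⟩
  have hTQ : ∀ t ∈ T, ∀ q ∈ Q, ¬ G.Adj t q := by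
    obtain ⟨S, A, B, -, hST⟩ := hex T subset_rfl
    exact fun t ht => (mem_awayPart.1 (Finset.inter_eq_left.1 hST ht)).2
  choose! S A B hg hS using fun t (ht : t ∈ T) => hex {t} (Finset.singleton_subset_iff.2 ht)
  have hmem : ∀ t ∈ T, ∀ t' ∈ T, t' ∈ S t ↔ t' = t := by
    intro t ht t' ht'
    rw [← Finset.mem_singleton, ← hS t ht]
    rw [Finset.mem_inter, mem_awayPart, and_iff_right ht', and_iff_left (hTQ t' ht')]
  exact PrivateFamily.card_le (S := fun t => S t) ⟨hg, fun t ht => (hmem t ht t ht).2 rfl,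
    fun t ht t' ht' => (hmem t ht t' ht').1, hTQ⟩ hG hP hQ

theorem card_guardedSets_le (hG : ¬ InducedMinor butterfly G) {P Q : Finset V}
    (hP : P.card ≤ 4) (hQ : Q.card ≤ 4) :
    (guardedSets G P Q).card ≤ (Fintype.card V + 1) ^ 128 := by
  classical
  have hsub : ∀ {S S' : Finset V}, S ∈ guardedSets G P Q → S' ∈ guardedSets G P Q →
      awayPart G Q S = awayPart G Q S' → awayPart G P S = awayPart G P S' → S ⊆ S' := by
    intro S S' hS hS' hQS hPS s hs
    obtain ⟨A, B, hg⟩ := mem_guardedSets.1 hS'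
    by_cases hsQ : ∀ q ∈ Q, ¬ G.Adj s q
    · exact (mem_awayPart.1 (hQS ▸ mem_awayPart.2 ⟨hs, hsQ⟩)).1
    by_cases hsP : ∀ p ∈ P, ¬ G.Adj s p
    · exact (mem_awayPart.1 (hPS ▸ mem_awayPart.2 ⟨hs, hsP⟩)).1
    push Not at hsQ hsP
    obtain ⟨q, hq, hsq⟩ := hsQ
    obtain ⟨p, hp, hsp⟩ := hsP
    exact hg.isFullPair.mem_of_adj_of_adj (hg.left_subset hp) (hg.right_subset hq) hsp.symm hsq.symm
  have hinj : Set.InjOn (fun S => (awayPart G Q S, awayPart G P S))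
      (guardedSets G P Q : Set (Finset V)) := by
    intro S hS S' hS' heq
    obtain ⟨hQS, hPS⟩ := Prod.mk.inj heq
    exact (hsub hS hS' hQS hPS).antisymm (hsub hS' hS hQS.symm hPS.symm)
  have hmaps : Set.MapsTo (fun S => (awayPart G Q S, awayPart G P S))
      (guardedSets G P Q : Set (Finset V))
      ((guardedSets G P Q).image (awayPart G Q) ×ˢ (guardedSets G P Q).image (awayPart G P) :
        Finset (Finset V × Finset V)) := fun S hS =>
    Finset.mem_product.2 ⟨Finset.mem_image_of_mem _ hS, Finset.mem_image_of_mem _ hS⟩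
  refine (Finset.card_le_card_of_injOn _ hmaps hinj).trans ?_
  rw [Finset.card_product]
  have h₁ := card_image_awayPart_le hG hP hQ
  have h₂ := card_image_awayPart_le hG hQ hP
  rw [guardedSets_comm] at h₂
  exact (Nat.mul_le_mul h₁ h₂).trans_eq (by rw [← pow_add])

theorem ncard_minimalSeparators_le (hG : ¬ InducedMinor butterfly G) :
    {S : Set V | IsMinimalSeparator G S}.ncard ≤ (Fintype.card V + 1) ^ 136 := by
  classical
  set F : Finset (Finset V) := (smallSets V 4 ×ˢ smallSets V 4).biUnion
    fun x => guardedSets G x.1 x.2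
  have hsub : {S : Set V | IsMinimalSeparator G S} ⊆
      (fun S : Finset V => (S : Set V)) '' (F : Set (Finset V)) := by
    intro S hS
    obtain ⟨A, B, hAB⟩ := IsMinimalSeparator.exists_isFullPair hS
    obtain ⟨P, Q, hP, hQ, hg⟩ := hAB.exists_guarded hG
    lift S to Finset V using Set.toFinite S
    lift P to Finset V using Set.toFinite P
    lift Q to Finset V using Set.toFinite Q
    rw [Set.ncard_coe_finset] at hP hQ
    exact ⟨S, Finset.mem_coe.2 (Finset.mem_biUnion.2 ⟨(P, Q),
      Finset.mem_product.2 ⟨mem_smallSets.2 hP, mem_smallSets.2 hQ⟩,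
      mem_guardedSets.2 ⟨A, B, hg⟩⟩), rfl⟩
  calc {S : Set V | IsMinimalSeparator G S}.ncard
      ≤ F.card := by
        rw [← Set.ncard_coe_finset]
        exact (Set.ncard_le_ncard hsub (Set.toFinite _)).trans (Set.ncard_image_le (Set.toFinite _))
    _ ≤ (smallSets V 4 ×ˢ smallSets V 4).card * (Fintype.card V + 1) ^ 128 :=
        Finset.card_biUnion_le_card_mul _ _ _ fun x hx => by
          rw [Finset.mem_product, mem_smallSets, mem_smallSets] at hx
          exact card_guardedSets_le hG hx.1 hx.2
    _ ≤ (Fintype.card V + 1) ^ 4 * (Fintype.card V + 1) ^ 4 * (Fintype.card V + 1) ^ 128 := by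
        rw [Finset.card_product]
        gcongr <;> exact card_smallSets_le 4
    _ = (Fintype.card V + 1) ^ 136 := by ring

end Counting

theorem butterfly_induced_minor_free_tame :
    Tame (fun n (G : SimpleGraph (Fin n)) => ¬ InducedMinor butterfly G) := by
  refine ⟨(Polynomial.X + 1) ^ 136, fun n G hG => ?_⟩
  simpa [numMinSep] using ncard_minimalSeparators_le hG
end

section
/- Every finite simple graph that does not contain an induced subdivision of the house is 3-creature-free. -/
open SimpleGraph

/-- An induced path `p 0, …, p n`. -/
def IndPath {V : Type} (G : SimpleGraph V) (p : ℕ → V) (n : ℕ) : Prop :=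
  ∀ s ≤ n, ∀ t ≤ n, (p s = p t → s = t) ∧ (G.Adj (p s) (p t) ↔ s = t + 1 ∨ t = s + 1)

/-- Three induced paths `f i 0, …, f i (n i)` with a common first vertex and no other
coincidences or adjacencies between them. -/
def IsSpider {V : Type} (G : SimpleGraph V) (f : Fin 3 → ℕ → V) (n : Fin 3 → ℕ) : Prop :=
  ∀ i j s t, s ≤ n i → t ≤ n j →
    (f i s = f j t ↔ s = t ∧ (i = j ∨ s = 0)) ∧
    (G.Adj (f i s) (f j t) ↔ (s = t + 1 ∧ (i = j ∨ t = 0)) ∨ (t = s + 1 ∧ (i = j ∨ s = 0)))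

/-- A vertex `o` outside a spider whose neighbours in the spider are exactly the ends of
its legs. -/
def IsApex {V : Type} (G : SimpleGraph V) (f : Fin 3 → ℕ → V) (n : Fin 3 → ℕ) (o : V) : Prop :=
  ∀ i s, s ≤ n i → o ≠ f i s ∧ (G.Adj o (f i s) ↔ ∃ j, n j = s ∧ (i = j ∨ s = 0))

/-- Some subdivision of the house consists of a spider with leg lengths `n` and an apex. -/
def HouseModel (n : Fin 3 → ℕ) : Prop :=
  ∃ (B : Type) (H : SimpleGraph B) (o : B) (g : Fin 3 → ℕ → B), Subdivision house H ∧
    IsSpider H g n ∧ IsApex H g n o ∧ ∀ b, b = o ∨ ∃ i s, s ≤ n i ∧ b = g i s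

lemma houseModel_base : HouseModel ![0, 1, 2] := by
  refine ⟨Fin 5, house, 0, ![fun _ => 3, fun s => if s = 0 then 3 else 4,
    fun s => if s = 0 then 3 else if s = 1 then 2 else 1], .refl _, ?_, ?_, ?_⟩
  · intro i j s t hs ht
    fin_cases i <;> fin_cases j <;> simp at hs ht <;> (try subst hs) <;> (try subst ht) <;>
      (try interval_cases s) <;> (try interval_cases t) <;> simp [house]
  · intro i s hs
    fin_cases i <;> simp at hs <;> (try subst hs) <;> (try interval_cases s) <;>
      simp [house, Fin.exists_fin_succ]
  · intro b
    fin_cases b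
    · exact .inl rfl
    · exact .inr ⟨2, 2, by simp⟩
    · exact .inr ⟨2, 1, by simp⟩
    · exact .inr ⟨0, 0, by simp⟩
    · exact .inr ⟨1, 1, by simp⟩

lemma subdivideEdge_some_some {W : Type} (H : SimpleGraph W) (u v a b : W) :
    (subdivideEdge H u v).Adj (some a) (some b) ↔
      H.Adj a b ∧ ¬(a = u ∧ b = v) ∧ ¬(a = v ∧ b = u) := by
  have := H.adj_comm a b
  have : H.Adj a b → a ≠ b := fun h => h.ne
  simp [subdivideEdge]
  grind

lemma subdivideEdge_none_some {W : Type} (H : SimpleGraph W) (u v b : W) :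
    (subdivideEdge H u v).Adj none (some b) ↔ b = u ∨ b = v := by
  simp [subdivideEdge]

lemma HouseModel.succ {n : Fin 3 → ℕ} (h : HouseModel n) (e : Fin 3)
    (hn : ∀ j, n j = 0 → n e = 0 → j = e) :
    HouseModel (Function.update n e (n e + 1)) := by
  obtain ⟨B, H, o, g, hH, hg, ho, hB⟩ := h
  have hoe : H.Adj o (g e (n e)) := ((ho e (n e) le_rfl).2).2 ⟨e, rfl, .inl rfl⟩
  let g' : Fin 3 → ℕ → Option B := fun i s => if s ≤ n i then some (g i s) else none
  have hle : ∀ i s, s ≤ Function.update n e (n e + 1) i → s ≤ n i ∨ (i = e ∧ s = n e + 1) := by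
    intro i s
    by_cases hi : i = e
    · subst hi; rw [Function.update_self]; omega
    · rw [Function.update_of_ne hi]; omega
  have hg_some : ∀ i s, s ≤ n i → g' i s = some (g i s) := fun i s h => by simp [g', h]
  have hg_none : g' e (n e + 1) = none := by simp [g']
  refine ⟨Option B, subdivideEdge H o (g e (n e)), some o, g', .step hH hoe, ?_, ?_, ?_⟩
  · intro i j s t hs ht
    rcases hle i s hs with hs' | ⟨rfl, rfl⟩ <;> rcases hle j t ht with ht' | ⟨rfl, rfl⟩ <;>
      clear hs ht
    · rw [hg_some i s hs', hg_some j t ht', subdivideEdge_some_some]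
      have h1 := (ho i s hs').1
      have h2 := (ho j t ht').1
      have h3 := hg i j s t hs' ht'
      simp only [Option.some.injEq]
      grind
    · rw [hg_some i s hs', hg_none, SimpleGraph.adj_comm, subdivideEdge_none_some]
      have h1 := (ho i s hs').1
      have h2 := hg i j s (n j) hs' le_rfl
      simp only [reduceCtorEq]
      grind
    · rw [hg_some j t ht', hg_none, subdivideEdge_none_some]
      have h1 := (ho j t ht').1
      have h2 := hg j i t (n i) ht' le_rfl
      simp only [reduceCtorEq]
      grind
    · simp
  · intro i s hs
    rcases hle i s hs with hs | ⟨rfl, rfl⟩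
    · rw [hg_some i s hs, subdivideEdge_some_some]
      obtain ⟨h1, h2⟩ := ho i s hs
      have h3 := hg i e s (n e) hs le_rfl
      refine ⟨by simpa using h1, ?_⟩
      have h4 : ¬ (o = g e (n e)) := hoe.ne
      rw [h2, h3.1]
      constructor
      · rintro ⟨⟨j, hj, hij⟩, h5, -⟩
        have : j ≠ e := by grind
        exact ⟨j, by simp [this, hj], hij⟩
      · rintro ⟨j, hj, hij⟩
        by_cases hje : j = e
        · subst hje; simp at hj; grind
        · simp [hje] at hj; grind
    · rw [hg_none, SimpleGraph.adj_comm, subdivideEdge_none_some]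
      simp
  · intro b
    rcases b with _ | b
    · exact .inr ⟨e, n e + 1, by simp, hg_none.symm⟩
    · rcases hB b with rfl | ⟨i, s, hs, rfl⟩
      · exact .inl rfl
      · refine .inr ⟨i, s, ?_, (hg_some i s hs).symm⟩
        by_cases hi : i = e
        · subst hi; simp; omega
        · simpa [hi] using hs

lemma houseModel_of_le (a b c : ℕ) : HouseModel ![a, b + 1, c + 2] := by
  induction a with
  | succ a ih =>
    convert ih.succ 0 (by intro j; fin_cases j <;> simp) using 1
    ext i; fin_cases i <;> simp
  | zero =>
  induction b with
  | succ b ih =>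
    convert ih.succ 1 (by simp) using 1
    ext i; fin_cases i <;> simp
  | zero =>
  induction c with
  | succ c ih =>
    convert ih.succ 2 (by simp) using 1
    ext i; fin_cases i <;> simp
  | zero => exact houseModel_base

lemma HouseModel.contains {V : Type} {G : SimpleGraph V} {f : Fin 3 → ℕ → V} {n : Fin 3 → ℕ}
    {o : V} (h : HouseModel n) (hf : IsSpider G f n) (ho : IsApex G f n o) :
    ContainsInducedSubdivision house G := by
  obtain ⟨B, H, o', g, hH, hg, ho', hB⟩ := h
  have key : ∀ b, ∃ v, (b = o' ∧ v = o) ∨ ∃ i s, s ≤ n i ∧ b = g i s ∧ v = f i s := by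
    intro b
    rcases hB b with h | ⟨i, s, hs, h⟩
    · exact ⟨o, .inl ⟨h, rfl⟩⟩
    · exact ⟨f i s, .inr ⟨i, s, hs, h, rfl⟩⟩
  choose φ hφ using key
  refine ⟨B, H, hH, ⟨⟨⟨φ, ?_⟩, ?_⟩⟩⟩
  · intro a b hab
    rcases hφ a with ⟨ha, ha'⟩ | ⟨i, s, hs, ha, ha'⟩ <;>
    rcases hφ b with ⟨hb, hb'⟩ | ⟨j, t, ht, hb, hb'⟩
    · rw [ha, hb]
    · exact absurd (ha'.symm.trans (hab.trans hb')) (ho j t ht).1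
    · exact absurd (hb'.symm.trans (hab.symm.trans ha')) (ho i s hs).1
    · rw [ha, hb, (hg i j s t hs ht).1, ← (hf i j s t hs ht).1, ← ha', ← hb', hab]
  · intro a b
    change G.Adj (φ a) (φ b) ↔ _
    rcases hφ a with ⟨ha, ha'⟩ | ⟨i, s, hs, ha, ha'⟩ <;>
    rcases hφ b with ⟨hb, hb'⟩ | ⟨j, t, ht, hb, hb'⟩ <;> rw [ha', hb', ha, hb]
    · simp
    · rw [(ho j t ht).2, (ho' j t ht).2]
    · rw [G.adj_comm, H.adj_comm, (ho i s hs).2, (ho' i s hs).2]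
    · rw [(hf i j s t hs ht).2, (hg i j s t hs ht).2]

lemma contains_of_spider_apex {V : Type} {G : SimpleGraph V} {f : Fin 3 → ℕ → V}
    {n : Fin 3 → ℕ} {o : V} (hf : IsSpider G f n) (ho : IsApex G f n o)
    {i j : Fin 3} (hij : i ≠ j) (h1 : 1 ≤ n i) (h2 : 2 ≤ n j) :
    ContainsInducedSubdivision house G := by
  obtain ⟨σ, rfl, rfl⟩ : ∃ σ : Equiv.Perm (Fin 3), σ 1 = i ∧ σ 2 = j := by
    clear h1 h2
    revert i j; decide
  have hn : HouseModel (n ∘ σ) := by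
    obtain ⟨b, hb⟩ := Nat.exists_eq_add_of_le' h1
    obtain ⟨c, hc⟩ := Nat.exists_eq_add_of_le' h2
    convert houseModel_of_le (n (σ 0)) b c using 1
    ext i; fin_cases i <;> simp [hb, hc]
  refine hn.contains (f := f ∘ σ) (o := o) ?_ ?_
  · intro i j s t hs ht
    have := hf (σ i) (σ j) s t hs ht
    simpa using this
  · intro i s hs
    obtain ⟨h3, h4⟩ := ho (σ i) s hs
    refine ⟨h3, h4.trans ?_⟩
    exact ⟨fun ⟨j, hj⟩ => ⟨σ.symm j, by simpa [Equiv.eq_symm_apply] using hj⟩,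
      fun ⟨j, hj⟩ => ⟨σ j, by simpa using hj⟩⟩

lemma IndPath.mono {V : Type} {G : SimpleGraph V} {p : ℕ → V} {n m : ℕ} (h : IndPath G p n)
    (hm : m ≤ n) : IndPath G p m :=
  fun s hs t ht => h s (hs.trans hm) t (ht.trans hm)

lemma IndPath.reverse {V : Type} {G : SimpleGraph V} {p : ℕ → V} {n : ℕ} (h : IndPath G p n) :
    IndPath G (fun t => p (n - t)) n := by
  intro s hs t ht
  have := h (n - s) (by omega) (n - t) (by omega)
  refine ⟨fun he => ?_, this.2.trans ?_⟩
  · have := this.1 he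
    omega
  · omega

lemma IndPath.shift {V : Type} {G : SimpleGraph V} {p : ℕ → V} {n : ℕ} (h : IndPath G p n)
    {k : ℕ} (hk : k ≤ n) : IndPath G (fun t => p (k + t)) (n - k) := by
  intro s hs t ht
  have := h (k + s) (by omega) (k + t) (by omega)
  refine ⟨fun he => ?_, this.2.trans ?_⟩
  · have := this.1 he
    omega
  · omega

/-- Prepending a vertex to an induced path. -/
lemma IndPath.cons {V : Type} {G : SimpleGraph V} {p : ℕ → V} {n : ℕ} (h : IndPath G p n)
    {v : V} (hv : ∀ t ≤ n, v ≠ p t ∧ (G.Adj v (p t) ↔ t = 0)) :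
    IndPath G (fun t => if t = 0 then v else p (t - 1)) (n + 1) := by
  intro s hs t ht
  rcases s with _ | s <;> rcases t with _ | t
  · simp
  · have := hv t (by omega)
    simp only [Nat.add_eq_zero_iff, one_ne_zero, and_false, if_false, if_true,
      Nat.add_sub_cancel]
    grind
  · have := hv s (by omega)
    simp only [Nat.add_eq_zero_iff, one_ne_zero, and_false, if_false, if_true,
      Nat.add_sub_cancel]
    rw [G.adj_comm]
    grind
  · have := h s (by omega) t (by omega)
    simp only [Nat.add_eq_zero_iff, one_ne_zero, and_false, if_false, Nat.add_sub_cancel]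
    grind

/-- Concatenating two induced paths joined by a single edge. -/
lemma IndPath.append {V : Type} {G : SimpleGraph V} {p q : ℕ → V} {n m : ℕ}
    (hp : IndPath G p n) (hq : IndPath G q m)
    (h : ∀ s ≤ n, ∀ t ≤ m, p s ≠ q t ∧ (G.Adj (p s) (q t) ↔ s = n ∧ t = 0)) :
    IndPath G (fun t => if t ≤ n then p t else q (t - (n + 1))) (n + (m + 1)) := by
  intro s hs t ht
  by_cases hsn : s ≤ n <;> by_cases htn : t ≤ n <;> simp only [hsn, htn, if_true, if_false]
  · exact hp s hsn t htn
  · have := h s hsn (t - (n + 1)) (by omega)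
    exact ⟨fun he => absurd he this.1, this.2.trans (by omega)⟩
  · have := h t htn (s - (n + 1)) (by omega)
    exact ⟨fun he => absurd he.symm this.1, (G.adj_comm _ _).trans (this.2.trans (by omega))⟩
  · have := hq (s - (n + 1)) (by omega) (t - (n + 1)) (by omega)
    exact ⟨fun he => by have := this.1 he; omega, this.2.trans (by omega)⟩

lemma isSpider_of_legs {V : Type} {G : SimpleGraph V} {f : Fin 3 → ℕ → V} {n : Fin 3 → ℕ}
    (hp : ∀ i, IndPath G (f i) (n i)) (h0 : ∀ i j, f i 0 = f j 0)
    (h : ∀ i j s t, i < j → 1 ≤ s → s ≤ n i → 1 ≤ t → t ≤ n j →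
      f i s ≠ f j t ∧ ¬ G.Adj (f i s) (f j t)) : IsSpider G f n := by
  intro i j s t hs ht
  by_cases hij : i = j
  · subst hij
    have := hp i s hs t ht
    grind
  rcases Nat.eq_zero_or_pos s with rfl | hs0
  · rw [h0 i j]
    have := hp j 0 (by omega) t ht
    grind
  rcases Nat.eq_zero_or_pos t with rfl | ht0
  · rw [h0 j i]
    have := hp i s hs 0 (by omega)
    grind
  have key : f i s ≠ f j t ∧ ¬ G.Adj (f i s) (f j t) := by
    rcases lt_or_gt_of_ne hij with hlt | hlt
    · exact h i j s t hlt hs0 hs ht0 ht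
    · have := h j i t s hlt ht0 ht hs0 hs
      exact ⟨this.1.symm, fun h => this.2 h.symm⟩
  grind

/-- Two disjoint spiders joined exactly by edges between corresponding ends. -/
lemma contains_of_spiders {V : Type} {G : SimpleGraph V} {f f' : Fin 3 → ℕ → V}
    {n n' : Fin 3 → ℕ} (hf : IsSpider G f n) (hf' : IsSpider G f' n')
    (hd : ∀ i j s t, s ≤ n i → t ≤ n' j → f i s ≠ f' j t ∧ (G.Adj (f i s) (f' j t) ↔
      ∃ e, s = n e ∧ (i = e ∨ s = 0) ∧ t = n' e ∧ (j = e ∨ t = 0)))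
    {k l : Fin 3} (hkl : k ≠ l) (h1 : 1 ≤ n k + n' k) (h2 : 2 ≤ n l + n' l) :
    ContainsInducedSubdivision house G := by
  refine contains_of_spider_apex
    (f := fun i s => if s ≤ n i then f i s else f' i (n i + n' i + 1 - s))
    (n := fun i => n i + n' i) (o := f' 0 0) ?_ ?_ hkl h1 h2
  · intro i j s t hs ht
    by_cases hsn : s ≤ n i <;> by_cases htn : t ≤ n j <;> simp only [hsn, htn, if_true, if_false]
    · exact hf i j s t hsn htn
    · have := hd i j s (n j + n' j + 1 - t) hsn (by omega)
      refine ⟨by grind, this.2.trans ?_⟩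
      constructor
      · grind
      · rintro (h | h)
        · grind
        · refine ⟨j, ?_⟩
          grind
    · have := hd j i t (n i + n' i + 1 - s) htn (by omega)
      rw [G.adj_comm]
      refine ⟨by grind, this.2.trans ?_⟩
      constructor
      · grind
      · rintro (h | h)
        · refine ⟨i, ?_⟩
          grind
        · grind
    · have := hf' i j (n i + n' i + 1 - s) (n j + n' j + 1 - t) (by omega) (by omega)
      grind
  · intro i s hs
    dsimp only at hs ⊢
    have h0 : f' 0 0 = f' i 0 := ((hf' 0 i 0 0 (by omega) (by omega)).1).2 (by simp)
    by_cases hsn : s ≤ n i <;> simp only [hsn, if_true, if_false]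
    · have := hd i i s 0 hsn (by omega)
      rw [h0, G.adj_comm, this.2]
      refine ⟨this.1.symm, exists_congr fun e => ?_⟩
      grind
    · have := hf' i i 0 (n i + n' i + 1 - s) (by omega) (by omega)
      rw [h0]
      refine ⟨by grind, this.2.trans ?_⟩
      constructor
      · intro h
        exact ⟨i, by omega, .inl rfl⟩
      · rintro ⟨e, he, h⟩
        have : i = e := by grind
        subst this
        simp; omega

/-- `u` and `v` are joined by an induced path inside `S`. -/
def Linked {V : Type} (G : SimpleGraph V) (S : Set V) (u v : V) : Prop :=
  ∃ (p : ℕ → V) (n : ℕ), p 0 = u ∧ p n = v ∧ IndPath G p n ∧ ∀ t ≤ n, p t ∈ S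

lemma linked_of_reflTransGen {V : Type} {G : SimpleGraph V} {S : Set V} {u v : V} (hu : u ∈ S)
    (h : Relation.ReflTransGen (fun a b => G.Adj a b ∧ b ∈ S) u v) : Linked G S u v := by
  classical
  induction h with
  | refl =>
    refine ⟨fun _ => u, 0, rfl, rfl, ?_, fun _ _ => hu⟩
    intro s hs t ht
    simp; omega
  | @tail b c _ hbc ih =>
    obtain ⟨p, n, hp0, hpn, hp, hS⟩ := ih
    have hex : ∃ s, s ≤ n ∧ (p s = c ∨ G.Adj (p s) c) := ⟨n, le_rfl, .inr (hpn ▸ hbc.1)⟩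
    obtain ⟨hm, hmc⟩ := Nat.find_spec hex
    have hmin : ∀ s < Nat.find hex, ¬ (s ≤ n ∧ (p s = c ∨ G.Adj (p s) c)) :=
      fun s hs => Nat.find_min hex hs
    generalize Nat.find hex = m at hm hmc hmin
    by_cases hc : p m = c
    · exact ⟨p, m, hp0, hc, hp.mono hm, fun t ht => hS t (ht.trans hm)⟩
    · refine ⟨fun t => if t ≤ m then p t else c, m + (0 + 1), by simp [hp0], by simp,
        (hp.mono hm).append (q := fun _ => c) ?_ ?_, ?_⟩
      · intro s hs t ht
        simp; omega
      · intro s hs t ht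
        rcases hs.lt_or_eq with hlt | rfl
        · have := hmin s hlt
          grind
        · grind
      · intro t ht
        dsimp only
        split_ifs with h
        · exact hS t (h.trans hm)
        · exact hbc.2

lemma isSpider_three {V : Type} {G : SimpleGraph V} {p q r : ℕ → V} {a b c : ℕ}
    (hp : IndPath G p a) (hq : IndPath G q b) (hr : IndPath G r c)
    (hpq0 : p 0 = q 0) (hpr0 : p 0 = r 0)
    (hpq : ∀ s t, 1 ≤ s → s ≤ a → 1 ≤ t → t ≤ b → p s ≠ q t ∧ ¬ G.Adj (p s) (q t))
    (hpr : ∀ s t, 1 ≤ s → s ≤ a → 1 ≤ t → t ≤ c → p s ≠ r t ∧ ¬ G.Adj (p s) (r t))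
    (hqr : ∀ s t, 1 ≤ s → s ≤ b → 1 ≤ t → t ≤ c → q s ≠ r t ∧ ¬ G.Adj (q s) (r t)) :
    IsSpider G ![p, q, r] ![a, b, c] := by
  refine isSpider_of_legs ?_ ?_ ?_
  · intro i
    fin_cases i <;> simpa
  · intro i j
    fin_cases i <;> fin_cases j <;> simp <;> grind
  · intro i j s t hij hs hs' ht ht'
    fin_cases i <;> fin_cases j <;> first | exact absurd hij (by decide) | skip
    · exact hpq s t hs hs' ht ht'
    · exact hpr s t hs hs' ht ht'
    · exact hqr s t hs hs' ht ht'

/-- A spider inside `S` whose legs end in `z 0`, `z 1`, `z 2`. -/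
def Tripod {V : Type} (G : SimpleGraph V) (S : Set V) (z : Fin 3 → V) : Prop :=
  ∃ (f : Fin 3 → ℕ → V) (n : Fin 3 → ℕ), IsSpider G f n ∧ (∀ i, f i (n i) = z i) ∧
    ∀ i s, s ≤ n i → f i s ∈ S

/-- Inside `S`, an induced path `p` from `x` to `y` together with a second path joining two
consecutive vertices of `p`, whose inner vertices `u 1, …, u m` have no other neighbours
in `p`. -/
def ChordedPath {V : Type} (G : SimpleGraph V) (S : Set V) (x y : V) : Prop :=
  ∃ (p : ℕ → V) (k : ℕ) (u : ℕ → V) (m s : ℕ), IndPath G p k ∧ p 0 = x ∧ p k = y ∧ s < k ∧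
    IndPath G u m ∧ 1 ≤ m ∧ u 0 = p (s + 1) ∧
    (∀ j t, 1 ≤ j → j ≤ m → t ≤ k → u j ≠ p t ∧
      (G.Adj (u j) (p t) ↔ (j = 1 ∧ t = s + 1) ∨ (j = m ∧ t = s))) ∧
    (∀ t ≤ k, p t ∈ S) ∧ ∀ j ≤ m, u j ∈ S

lemma ChordedPath.contains {V : Type} {G : SimpleGraph V} {S S' : Set V} {x y x' y' : V}
    (h : ChordedPath G S x y) (h' : Linked G S' x' y') (hxy : x' ≠ y')
    (hc : ∀ a ∈ S, ∀ b ∈ S', a ≠ b ∧ (G.Adj a b ↔ (a = x ∧ b = x') ∨ (a = y ∧ b = y'))) :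
    ContainsInducedSubdivision house G := by
  obtain ⟨p, k, u, m, s, hp, hp0, hpk, hsk, hu, hm, hu0, hup, hpS, huS⟩ := h
  obtain ⟨q, l, hq0, hql, hq, hqS⟩ := h'
  have hl : 1 ≤ l := by
    by_contra h
    obtain rfl : l = 0 := by omega
    exact hxy (hq0.symm.trans hql)
  have hpq : ∀ a ≤ k, ∀ b ≤ l, p a ≠ q b ∧ (G.Adj (p a) (q b) ↔ (a = 0 ∧ b = 0) ∨
      (a = k ∧ b = l)) := by
    intro a ha b hb
    obtain ⟨h1, h2⟩ := hc _ (hpS a ha) _ (hqS b hb)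
    refine ⟨h1, h2.trans ?_⟩
    have e1 := (hp a ha 0 (by omega)).1
    have e2 := (hp a ha k le_rfl).1
    have e3 := (hq b hb 0 (by omega)).1
    have e4 := (hq b hb l le_rfl).1
    grind
  have huq : ∀ j, 1 ≤ j → j ≤ m → ∀ b ≤ l, u j ≠ q b ∧ ¬ G.Adj (u j) (q b) := by
    intro j hj hj' b hb
    obtain ⟨h1, h2⟩ := hc _ (huS j hj') _ (hqS b hb)
    have e1 := (hup j 0 hj hj' (by omega)).1
    have e2 := (hup j k hj hj' le_rfl).1
    grind
  let R : ℕ → V := fun t => if t ≤ s then p (s - t) else q (t - (s + 1))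
  have hR : IndPath G R (s + (l + 1)) := by
    refine (hp.mono hsk.le).reverse.append hq ?_
    intro a ha b hb
    have := hpq (s - a) (by omega) b hb
    refine ⟨this.1, this.2.trans ?_⟩
    omega
  have hR0 : R 0 = p s := by simp [R]
  have hpR : ∀ a b, a ≤ k - (s + 1) → b ≤ s + (l + 1) → p (s + 1 + a) ≠ R b ∧
      (G.Adj (p (s + 1 + a)) (R b) ↔ (a = 0 ∧ b = 0) ∨ (a = k - (s + 1) ∧ b = s + (l + 1))) := by
    intro a b ha hb
    by_cases hbs : b ≤ s <;> simp only [R, hbs, if_true, if_false]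
    · have := hp (s + 1 + a) (by omega) (s - b) (by omega)
      refine ⟨fun h => by have := this.1 h; omega, this.2.trans (by omega)⟩
    · have := hpq (s + 1 + a) (by omega) (b - (s + 1)) (by omega)
      exact ⟨this.1, this.2.trans (by omega)⟩
  have huR : ∀ j b, 1 ≤ j → j ≤ m → b ≤ s + (l + 1) → u j ≠ R b ∧
      (G.Adj (u j) (R b) ↔ j = m ∧ b = 0) := by
    intro j b hj hj' hb
    by_cases hbs : b ≤ s <;> simp only [R, hbs, if_true, if_false]
    · have := hup j (s - b) hj hj' (by omega)
      exact ⟨this.1, this.2.trans (by omega)⟩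
    · have := huq j hj hj' (b - (s + 1)) (by omega)
      exact ⟨this.1, iff_of_false this.2 (by omega)⟩
  have huR' : ∀ j b, j ≤ m → b ≤ s + (l + 1) → u j ≠ R b ∧
      (G.Adj (u j) (R b) ↔ (j = m ∧ b = 0) ∨ (j = 0 ∧ b = 0) ∨
        (j = 0 ∧ s + 1 = k ∧ b = s + (l + 1))) := by
    intro j b hj hb
    rcases Nat.eq_zero_or_pos j with rfl | hj0
    · rw [hu0]
      have := hpR 0 b (by omega) hb
      exact ⟨this.1, this.2.trans (by omega)⟩
    · have := huR j b hj0 hj hb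
      exact ⟨this.1, this.2.trans (by omega)⟩
  refine contains_of_spiders (f := ![fun _ => p (s + 1), u, fun t => p (s + 1 + t)])
    (n := ![0, m, k - (s + 1)]) (f' := ![fun _ => p s, fun _ => p s, R])
    (n' := ![0, 0, s + (l + 1)]) (k := 1) (l := 2) ?_ ?_ ?_ (by decide) (by simpa) (by simp; omega)
  · refine isSpider_three ?_ hu (hp.shift hsk) hu0.symm rfl ?_ ?_ ?_
    · exact fun a ha b hb => by simp; omega
    · intros; omega
    · intros; omega
    · intro a b ha ha' hb hb'
      have := hup a (s + 1 + b) ha ha' (by omega)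
      exact ⟨this.1, fun h => by have := this.2.1 h; omega⟩
  · refine isSpider_three ?_ ?_ hR rfl hR0.symm ?_ ?_ ?_
    · exact fun a ha b hb => by simp; omega
    · exact fun a ha b hb => by simp; omega
    all_goals intros; omega
  · intro i j a b ha hb
    rw [← hR0]
    have hp1 : p (s + 1) = p (s + 1 + 0) := rfl
    fin_cases i <;> fin_cases j <;> simp [Fin.exists_fin_succ] at ha hb ⊢
    · have := hpR 0 0 (by omega) (by omega)
      exact ⟨this.1, this.2.trans (by omega)⟩
    · have := hpR 0 0 (by omega) (by omega)
      exact ⟨this.1, this.2.trans (by omega)⟩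
    · have := hpR 0 b (by omega) (by omega)
      exact ⟨this.1, this.2.trans (by omega)⟩
    · have := huR' a 0 (by omega) (by omega)
      exact ⟨this.1, this.2.trans (by omega)⟩
    · have := huR' a 0 (by omega) (by omega)
      exact ⟨this.1, this.2.trans (by omega)⟩
    · have := huR' a b (by omega) (by omega)
      exact ⟨this.1, this.2.trans (by omega)⟩
    · have := hpR a 0 (by omega) (by omega)
      exact ⟨this.1, this.2.trans (by omega)⟩
    · have := hpR a 0 (by omega) (by omega)
      exact ⟨this.1, this.2.trans (by omega)⟩
    · have := hpR a b (by omega) (by omega)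
      exact ⟨this.1, this.2.trans (by omega)⟩

lemma chordedPath_of_adj {V : Type} {G : SimpleGraph V} {S : Set V} {x y a : V}
    (hxy : G.Adj x y) (hx : x ∉ S) (h : Linked G S y a) (ha : G.Adj a x) (hay : a ≠ y) :
    ChordedPath G (insert x S) x y := by
  classical
  obtain ⟨u, l, hu0, hul, hu, hS⟩ := h
  have hl : 1 ≤ l := by
    by_contra h
    obtain rfl : l = 0 := by omega
    exact hay (hul.symm.trans hu0)
  have hex : ∃ m, 1 ≤ m ∧ m ≤ l ∧ G.Adj (u m) x := ⟨l, hl, le_rfl, hul ▸ ha⟩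
  obtain ⟨hm1, hml, hmx⟩ := Nat.find_spec hex
  have hmin : ∀ m < Nat.find hex, ¬ (1 ≤ m ∧ m ≤ l ∧ G.Adj (u m) x) :=
    fun m hm => Nat.find_min hex hm
  generalize Nat.find hex = m at hm1 hml hmx hmin
  refine ⟨fun t => if t = 0 then x else y, 1, u, m, 0, ?_, rfl, rfl, one_pos, hu.mono hml, hm1,
    by simp [hu0], ?_, ?_, ?_⟩
  · intro s hs t ht
    have := hxy.ne
    interval_cases s <;> interval_cases t <;> simp [hxy, hxy.symm, this, this.symm]
  · intro j t hj hjm ht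
    interval_cases t
    · have h1 : u j ≠ x := fun h => hx (h ▸ hS j (by omega))
      have h2 := hmin j
      simp only [if_true]
      grind
    · have := hu j (by omega) 0 (by omega)
      simp only [one_ne_zero, if_false, ← hu0]
      exact ⟨fun h => by have := this.1 h; omega, this.2.trans (by simp)⟩
  · intro t _
    dsimp only
    split_ifs
    · exact Set.mem_insert _ _
    · exact Set.mem_insert_of_mem _ (hu0 ▸ hS 0 (by omega))
  · exact fun j hj => Set.mem_insert_of_mem _ (hS j (by omega))

/-- Three vertices of a connected set are the ends of a spider, or the first two are joined by
a chorded path. -/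
lemma tripod_or_chordedPath {V : Type} {G : SimpleGraph V} {S : Set V} {z : Fin 3 → V}
    (h01 : Linked G S (z 0) (z 1)) (h20 : Linked G S (z 2) (z 0)) :
    Tripod G S z ∨ ChordedPath G S (z 0) (z 1) := by
  classical
  obtain ⟨p, k, hp0, hpk, hp, hpS⟩ := h01
  obtain ⟨r, l, hr0, hrl, hr, hrS⟩ := h20
  have hex : ∃ m, m ≤ l ∧ ∃ s ≤ k, r m = p s ∨ G.Adj (r m) (p s) :=
    ⟨l, le_rfl, 0, by omega, .inl (hrl.trans hp0.symm)⟩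
  obtain ⟨hml, hm⟩ := Nat.find_spec hex
  have hmin : ∀ m < Nat.find hex, ∀ s ≤ k, r m ≠ p s ∧ ¬ G.Adj (r m) (p s) := by
    intro m hm s hs
    have h1 := Nat.find_min hex hm
    have h2 := Nat.find_spec hex
    grind
  generalize Nat.find hex = m at hml hm hmin
  clear hex hrl
  replace hr := (hr.mono hml).reverse
  replace hmin : ∀ t, 1 ≤ t → t ≤ m → ∀ s ≤ k, r (m - t) ≠ p s ∧ ¬ G.Adj (r (m - t)) (p s) :=
    fun t ht ht' => hmin (m - t) (by omega)
  have hrS' : ∀ t, r (m - t) ∈ S := fun t => hrS _ (by omega)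
  have hrm : r (m - m) = z 2 := by simpa using hr0
  generalize hR : (fun t => r (m - t)) = R at hr
  simp only [show ∀ t, r (m - t) = R t from fun t => congrFun hR t] at hmin hrS' hrm
  have hR0 : r m = R 0 := by simp [← hR]
  rw [hR0] at hm
  clear hR hR0 hr0 hrS hml r
  by_cases hmp : ∃ s ≤ k, R 0 = p s
  · obtain ⟨s, hs, hRs⟩ := hmp
    left
    refine ⟨![fun t => p (s - t), fun t => p (s + t), R], ![s, k - s, m],
      isSpider_three (hp.mono hs).reverse (hp.shift hs) hr rfl hRs.symm ?_ ?_ ?_, ?_, ?_⟩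
    · intro a b ha ha' hb hb'
      have := hp (s - a) (by omega) (s + b) (by omega)
      exact ⟨fun h => by have := this.1 h; omega, fun h => by have := this.2.1 h; omega⟩
    · intro a b ha ha' hb hb'
      have := hmin b hb hb' (s - a) (by omega)
      exact ⟨this.1.symm, fun h => this.2 h.symm⟩
    · intro a b ha ha' hb hb'
      have := hmin b hb hb' (s + a) (by omega)
      exact ⟨this.1.symm, fun h => this.2 h.symm⟩
    · intro i
      fin_cases i <;> simp [hs, hp0, hpk, hrm]
    · intro i a ha
      fin_cases i <;> simp at ha ⊢
      · exact hpS _ (by omega)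
      · exact hpS _ (by omega)
      · exact hrS' _
  · have hne : ∀ s ≤ k, R 0 ≠ p s := fun s hs h => hmp ⟨s, hs, h⟩
    have hadj : ∃ s, s ≤ k ∧ G.Adj (R 0) (p s) := by
      obtain ⟨s, hs, h | h⟩ := hm
      · exact absurd h (hne s hs)
      · exact ⟨s, hs, h⟩
    have hadj' : ∃ s, s ≤ k ∧ G.Adj (R 0) (p (k - s)) := by
      obtain ⟨s, hs, h⟩ := hadj
      exact ⟨k - s, by omega, by rwa [Nat.sub_sub_self hs]⟩
    obtain ⟨s, hs, hsadj, hsmin⟩ : ∃ s ≤ k, G.Adj (R 0) (p s) ∧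
        ∀ a < s, ¬ G.Adj (R 0) (p a) := by
      have h1 := Nat.find_spec hadj
      exact ⟨Nat.find hadj, h1.1, h1.2, fun a ha h => Nat.find_min hadj ha ⟨by omega, h⟩⟩
    obtain ⟨t, ht, htadj, htmax⟩ : ∃ t ≤ k, G.Adj (R 0) (p t) ∧
        ∀ a, t < a → a ≤ k → ¬ G.Adj (R 0) (p a) := by
      have h1 := Nat.find_spec hadj'
      refine ⟨k - Nat.find hadj', by omega, h1.2, fun a ha hak h => ?_⟩
      exact Nat.find_min hadj' (m := k - a) (by omega)
        ⟨by omega, by rwa [Nat.sub_sub_self hak]⟩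
    have hst : s ≤ t := by
      by_contra h
      exact hsmin t (by omega) htadj
    have hRp : ∀ b ≤ m, ∀ a ≤ k, R b ≠ p a := by
      intro b hb a ha
      rcases Nat.eq_zero_or_pos b with rfl | hb0
      · exact hne a ha
      · exact (hmin b hb0 hb a ha).1
    rcases hst.lt_or_eq with hst | rfl
    · rcases (Nat.succ_le_of_lt hst).lt_or_eq with hst' | rfl
      · left
        have hconsl := (hp.mono hs).reverse.cons (v := R 0) (fun a ha =>
          ⟨hne _ (by omega), fun h => by
            by_contra hc
            exact hsmin (s - a) (by omega) h, by rintro rfl; simpa using hsadj⟩)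
        have hconsr := (hp.shift ht).cons (v := R 0) (fun a ha =>
          ⟨hne _ (by omega), fun h => by
            by_contra hc
            exact htmax (t + a) (by omega) (by omega) h, by rintro rfl; simpa using htadj⟩)
        refine ⟨_, ![s + 1, k - t + 1, m], isSpider_three hconsl hconsr hr rfl rfl ?_ ?_ ?_, ?_, ?_⟩
        · intro a b ha ha' hb hb'
          have := hp (s - (a - 1)) (by omega) (t + (b - 1)) (by omega)
          simp only [show a ≠ 0 by omega, show b ≠ 0 by omega, if_false]
          exact ⟨fun h => by have := this.1 h; omega, fun h => by have := this.2.1 h; omega⟩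
        · intro a b ha ha' hb hb'
          simp only [show a ≠ 0 by omega, if_false]
          have := hmin b hb hb' (s - (a - 1)) (by omega)
          exact ⟨this.1.symm, fun h => this.2 h.symm⟩
        · intro a b ha ha' hb hb'
          simp only [show a ≠ 0 by omega, if_false]
          have := hmin b hb hb' (t + (a - 1)) (by omega)
          exact ⟨this.1.symm, fun h => this.2 h.symm⟩
        · intro i
          fin_cases i <;> simp [ht, hp0, hpk, hrm]
        · intro i a ha
          fin_cases i <;> simp at ha ⊢
          · split_ifs
            · exact hrS' _
            · exact hpS _ (by omega)
          · split_ifs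
            · exact hrS' _
            · exact hpS _ (by omega)
          · exact hrS' _
      · right
        refine ⟨p, k, fun j => if j = 0 then p (s + 1) else R 0, 1, s, hp, hp0, hpk, by omega, ?_,
          le_rfl, rfl, ?_, hpS, ?_⟩
        · have h1 := (hne (s + 1) ht).symm
          intro a ha b hb
          interval_cases a <;> interval_cases b <;> simp [h1, h1.symm, htadj, htadj.symm]
        · intro j a hj hj' ha
          obtain rfl : j = 1 := by omega
          simp only [one_ne_zero, if_false]
          refine ⟨hne a ha, ?_⟩
          have h1 := hsmin a
          have h2 := htmax a
          grind
        · intro j _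
          dsimp only
          split_ifs
          · exact hpS _ ht
          · exact hrS' _
    · left
      have hcons := hr.cons (v := p s) (fun b hb => ⟨(hRp b hb s hs).symm, fun h => by
        by_contra hc
        exact (hmin b (by omega) hb s hs).2 h.symm, by rintro rfl; exact hsadj.symm⟩)
      have hno : ∀ b, 1 ≤ b → b ≤ m + 1 → ∀ a ≤ k, a ≠ s →
          p a ≠ R (b - 1) ∧ ¬ G.Adj (p a) (R (b - 1)) := by
        intro b hb hb' a ha has
        refine ⟨(hRp _ (by omega) a ha).symm, fun h => ?_⟩
        rcases hb.lt_or_eq with hb1 | rfl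
        · exact (hmin (b - 1) (by omega) (by omega) a ha).2 h.symm
        · rcases has.lt_or_gt with h1 | h1
          · exact hsmin a h1 h.symm
          · exact htmax a h1 ha h.symm
      refine ⟨_, ![s, k - s, m + 1], isSpider_three (hp.mono hs).reverse (hp.shift hs) hcons rfl rfl
        ?_ ?_ ?_, ?_, ?_⟩
      · intro a b ha ha' hb hb'
        have := hp (s - a) (by omega) (s + b) (by omega)
        exact ⟨fun h => by have := this.1 h; omega, fun h => by have := this.2.1 h; omega⟩
      · intro a b ha ha' hb hb'
        simp only [show b ≠ 0 by omega, if_false]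
        exact hno b hb hb' (s - a) (by omega) (by omega)
      · intro a b ha ha' hb hb'
        simp only [show b ≠ 0 by omega, if_false]
        exact hno b hb hb' (s + a) (by omega) (by omega)
      · intro i
        fin_cases i <;> simp [hs, hp0, hpk, hrm]
      · intro i a ha
        fin_cases i <;> simp at ha ⊢
        · exact hpS _ (by omega)
        · exact hpS _ (by omega)
        · split_ifs
          · exact hpS _ hs
          · exact hrS' _

lemma contains_of_tripods {V : Type} {G : SimpleGraph V} {S S' : Set V} {x y : Fin 3 → V}
    (hx : Function.Injective x) (hy : Function.Injective y)
    (h : Tripod G S x) (h' : Tripod G S' y) (hxx : ∀ i j, ¬ G.Adj (x i) (x j))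
    (hc : ∀ a ∈ S, ∀ b ∈ S', a ≠ b ∧ (G.Adj a b ↔ ∃ e, a = x e ∧ b = y e)) :
    ContainsInducedSubdivision house G := by
  obtain ⟨f, n, hf, hfx, hfS⟩ := h
  obtain ⟨f', n', hf', hfy, hfS'⟩ := h'
  have h1 : ∀ i j, i ≠ j → n i = 0 → 2 ≤ n j := by
    intro i j hij hi
    have := hf i j (n i) (n j) le_rfl le_rfl
    rw [hfx, hfx] at this
    have h2 := mt (@hx i j) hij
    have h3 := hxx i j
    by_contra hlt
    have : n j = 0 ∨ n j = 1 := by omega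
    grind
  have h2 : ∀ i j, i ≠ j → n' i = 0 → 1 ≤ n' j := by
    intro i j hij hi
    have := hf' i j (n' i) (n' j) le_rfl le_rfl
    rw [hfy, hfy] at this
    have h2 := mt (@hy i j) hij
    by_contra hlt
    grind
  obtain ⟨k, l, hkl, hk, hl⟩ : ∃ k l : Fin 3, k ≠ l ∧ 1 ≤ n k + n' k ∧ 2 ≤ n l + n' l := by
    have := h1 0 1 (by decide)
    have := h1 0 2 (by decide)
    have := h1 1 0 (by decide)
    have := h1 1 2 (by decide)
    have := h2 0 1 (by decide)
    by_cases h0 : 1 ≤ n 0 ∧ 2 ≤ n 1 + n' 1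
    · exact ⟨0, 1, by decide, by omega, h0.2⟩
    by_cases h0 : 1 ≤ n 1 ∧ 2 ≤ n 0 + n' 0
    · exact ⟨1, 0, by decide, by omega, h0.2⟩
    by_cases h0 : n 0 = 0
    · exact ⟨1, 2, by decide, by omega, by omega⟩
    · exact ⟨0, 2, by decide, by omega, by omega⟩
  refine contains_of_spiders hf hf' ?_ hkl hk hl
  intro i j s t hs ht
  obtain ⟨h3, h4⟩ := hc _ (hfS i s hs) _ (hfS' j t ht)
  refine ⟨h3, h4.trans (exists_congr fun e => ?_)⟩
  rw [← hfx, ← hfy, (hf i e s (n e) hs le_rfl).1, (hf' j e t (n' e) ht le_rfl).1]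
  tauto

lemma reflTransGen_of_connected {V : Type} {G : SimpleGraph V} {A S : Set V} {u a b : V}
    (hA : (G.induce A).Connected) (hAS : A ⊆ S) (ha : a ∈ A) (hua : G.Adj u a) (hb : b ∈ A) :
    Relation.ReflTransGen (fun a b => G.Adj a b ∧ b ∈ S) u b := by
  refine .head ⟨hua, hAS ha⟩ ?_
  have := (reachable_iff_reflTransGen _ _).1 (hA.preconnected ⟨a, ha⟩ ⟨b, hb⟩)
  exact this.lift Subtype.val fun c d h => ⟨h, hAS d.2⟩

lemma linked_of_connected {V : Type} {G : SimpleGraph V} {A S : Set V} {u v : V}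
    (hA : (G.induce A).Connected) (hAS : A ⊆ S) (hu : u ∈ S) (hv : v ∈ S)
    (hua : ∃ a ∈ A, G.Adj u a) (hvb : ∃ b ∈ A, G.Adj v b) : Linked G S u v := by
  obtain ⟨a, ha, hua⟩ := hua
  obtain ⟨b, hb, hvb⟩ := hvb
  exact linked_of_reflTransGen hu
    ((reflTransGen_of_connected hA hAS ha hua hb).tail ⟨hvb.symm, hv⟩)

theorem house_subdivision_free_creature_free {V : Type} [Fintype V]
    (G : SimpleGraph V) (h : ¬ ContainsInducedSubdivision house G) :
    CreatureFree G 3 := by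
  rintro ⟨A, B, X, Y, -, -, hAB, hAX, hAY, hBX, hBY, hXY, hA, hB, hAB', hAY', hBX', hXA, hYB,
    x, y, hx, hy, rfl, rfl, hxy⟩
  apply h
  simp only [Set.forall_mem_range] at hAY' hBX' hXA hYB
  rw [Set.disjoint_left] at hAB hAX hAY hBX hBY hXY
  simp only [Set.mem_range, not_exists, forall_exists_index, forall_apply_eq_imp_iff]
    at hAX hAY hBX hBY hXY
  have hcross : ∀ a ∈ A ∪ Set.range x, ∀ b ∈ B ∪ Set.range y,
      a ≠ b ∧ (G.Adj a b ↔ ∃ e, a = x e ∧ b = y e) := by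
    rintro a (ha | ⟨i, rfl⟩) b (hb | ⟨j, rfl⟩)
    · have := hAB' a ha b hb
      grind
    · have := hAY' a ha j
      grind
    · have := hBX' b hb i
      rw [G.adj_comm]
      grind
    · have := hxy i j
      have := @hx i
      have := @hy j
      grind
  have hlinkB : ∀ i j, Linked G (B ∪ {y i, y j}) (y i) (y j) := fun i j =>
    linked_of_connected hB Set.subset_union_left (by simp) (by simp) (hYB i) (hYB j)
  have hlinkA : ∀ i j, Linked G (A ∪ {x i, x j}) (x i) (x j) := fun i j =>
    linked_of_connected hA Set.subset_union_left (by simp) (by simp) (hXA i) (hXA j)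
  have hlinkX : ∀ i j, Linked G (A ∪ Set.range x) (x i) (x j) := fun i j =>
    linked_of_connected hA Set.subset_union_left (by simp) (by simp) (hXA i) (hXA j)
  have hlinkY : ∀ i j, Linked G (B ∪ Set.range y) (y i) (y j) := fun i j =>
    linked_of_connected hB Set.subset_union_left (by simp) (by simp) (hYB i) (hYB j)
  by_cases hxx : ∃ i j, G.Adj (x i) (x j)
  · obtain ⟨i, j, hij⟩ := hxx
    have hne : i ≠ j := fun h => hij.ne (congrArg x h)
    obtain ⟨a, ha, hia⟩ := hXA i
    obtain ⟨b, hb, hjb⟩ := hXA j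
    have hlink : Linked G (A ∪ {x j}) (x j) a := linked_of_reflTransGen (by simp)
      (reflTransGen_of_connected hA Set.subset_union_left hb hjb ha)
    refine (chordedPath_of_adj hij ?_ hlink hia.symm ?_).contains (hlinkB i j) (hy.ne hne) ?_
    · grind
    · grind
    · intro c hc d hd
      have := hcross c (by grind) d (by grind)
      grind
  push Not at hxx
  rcases tripod_or_chordedPath (hlinkX 0 1) (hlinkX 2 0) with hT | hT
  · rcases tripod_or_chordedPath (hlinkY 0 1) (hlinkY 2 0) with hT' | hT'
    · exact contains_of_tripods hx hy hT hT' hxx hcross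
    · refine hT'.contains (hlinkA 0 1) (hx.ne (by decide)) ?_
      intro c hc d hd
      have := hcross d (by grind) c hc
      rw [G.adj_comm]
      grind
  · refine hT.contains (hlinkB 0 1) (hy.ne (by decide)) ?_
    intro c hc d hd
    have := hcross c hc d (by grind)
    grind
end
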